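/- Let k ≥ 2 be an integer and let p^k(n) denote the number of partitions of n into parts that are perfect k-th powers. For each large n let X = X(n) > 0 satisfy n = X((1/k²)ζ((k+1)/k)Γ(1/k)X^{1/k} − 1/2 − (1/2)ζ(−k)X^{−1}). Then p^k(n+1) − p^k(n) ∼ p^k(n)/X as n → ∞. -/

import Mathlib

open Real Complex Filter

/-- Real value of the Riemann zeta function at a real argument. -/
noncomputable def zetaR (x : ℝ) : ℝ := (riemannZeta (x : ℂ)).re

/-- The number of partitions of `n` into parts that are perfect `k`-th powers. -/
noncomputable def pk (k n : ℕ) : ℕ :=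
  Nat.card {p : n.Partition // ∀ i ∈ p.parts, ∃ m : ℕ, i = m ^ k}

/-- The number of partitions of `n` all of whose parts lie in `S`. -/
noncomputable def partCount (S : Set ℕ) (n : ℕ) : ℕ :=
  Nat.card {p : n.Partition // ∀ i ∈ p.parts, i ∈ S}

theorem partCount_congr {S T : Set ℕ} {n : ℕ} (h : ∀ i, 0 < i → i ≤ n → (i ∈ S ↔ i ∈ T)) :
    partCount S n = partCount T n := by
  unfold partCount
  refine Nat.card_congr (Equiv.subtypeEquivRight fun p => ?_)
  refine forall₂_congr fun i hi => h i (p.parts_pos hi) ?_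
  have := Multiset.le_sum_of_mem hi
  rwa [p.parts_sum] at this

theorem partCount_mono {S T : Set ℕ} (h : S ⊆ T) (n : ℕ) : partCount S n ≤ partCount T n :=
  Nat.card_le_card_of_injective (fun p => ⟨p.1, fun i hi => h (p.2 i hi)⟩)
    fun p q hpq => by
      have := congrArg Subtype.val hpq
      exact Subtype.ext this

theorem partCount_zero (S : Set ℕ) : partCount S 0 = 1 := by
  unfold partCount
  rw [Nat.card_eq_one_iff_unique]
  refine ⟨inferInstance, ⟨⟨default, fun i hi => ?_⟩⟩⟩
  have h1 := Nat.Partition.parts_pos _ hi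
  have h2 := Multiset.le_sum_of_mem hi
  rw [Nat.Partition.parts_sum] at h2
  omega

theorem partCount_eq_zero {S : Set ℕ} {n : ℕ} (hn : 0 < n) (h : ∀ i ∈ S, i ≤ n → i = 0) :
    partCount S n = 0 := by
  unfold partCount
  rw [Nat.card_eq_zero]
  left
  refine ⟨fun ⟨p, hp⟩ => ?_⟩
  have hz : ∀ i ∈ p.parts, i = 0 := fun i hi => h i (hp i hi) (by
    have := Multiset.le_sum_of_mem hi
    rwa [p.parts_sum] at this)
  have := Multiset.sum_eq_zero hz
  rw [p.parts_sum] at this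
  omega

theorem partCount_add {S : Set ℕ} {a : ℕ} (ha : a ∈ S) (ha0 : 0 < a) (n : ℕ) :
    partCount S (n + a) = partCount S n + partCount (S \ {a}) (n + a) := by
  classical
  unfold partCount
  rw [← Nat.card_sum]
  symm
  refine Nat.card_congr (Equiv.ofBijective (Sum.elim
    (fun p => ⟨⟨a ::ₘ p.1.parts, fun {i} hi => ?_, ?_⟩, fun i hi => ?_⟩)
    (fun p => ⟨p.1, fun i hi => (p.2 i hi).1⟩)) ⟨?_, ?_⟩)
  · rcases Multiset.mem_cons.1 hi with rfl | hi
    · exact ha0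
    · exact p.1.parts_pos hi
  · rw [Multiset.sum_cons, p.1.parts_sum, add_comm]
  · rcases Multiset.mem_cons.1 hi with rfl | hi
    · exact ha
    · exact p.2 i hi
  · rintro (p | p) (q | q) h
    · have := congrArg (fun x => x.1.parts) h
      simp only [Sum.elim_inl, Multiset.cons_inj_right] at this
      exact congrArg Sum.inl (Subtype.ext (Nat.Partition.ext this))
    · have := congrArg (fun x => x.1.parts) h
      simp only [Sum.elim_inl, Sum.elim_inr] at this
      exact absurd rfl (q.2 a (this ▸ Multiset.mem_cons_self a _)).2
    · have := congrArg (fun x => x.1.parts) h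
      simp only [Sum.elim_inl, Sum.elim_inr] at this
      exact absurd rfl (p.2 a (this.symm ▸ Multiset.mem_cons_self a _)).2
    · have := congrArg (fun x => x.1) h
      simp only [Sum.elim_inr] at this
      exact congrArg Sum.inr (Subtype.ext this)
  · rintro ⟨p, hp⟩
    by_cases hap : a ∈ p.parts
    · refine ⟨Sum.inl ⟨⟨p.parts.erase a, fun {i} hi => p.parts_pos (Multiset.mem_of_mem_erase hi),
        ?_⟩, fun i hi => hp i (Multiset.mem_of_mem_erase hi)⟩, ?_⟩
      · have := Multiset.sum_erase hap
        rw [p.parts_sum] at this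
        omega
      · refine Subtype.ext (Nat.Partition.ext ?_)
        simp [Multiset.cons_erase hap]
    · refine ⟨Sum.inr ⟨p, fun i hi => ⟨hp i hi, ?_⟩⟩, rfl⟩
      rintro rfl
      exact hap hi

theorem partCount_le_add_mul {S : Set ℕ} {a : ℕ} (ha : a ∈ S) (ha0 : 0 < a) (n i : ℕ) :
    partCount S n ≤ partCount S (n + i * a) := by
  induction i with
  | zero => simp
  | succ i ih =>
    rw [add_mul, one_mul, ← add_assoc, partCount_add ha ha0]
    omega

/-- Number of partitions into `k`-th powers of integers larger than `M`. -/
noncomputable def pkTail (k M n : ℕ) : ℕ := partCount {i | ∃ m, M < m ∧ i = m ^ k} n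

theorem pk_eq_pkTail {k : ℕ} (hk : k ≠ 0) (n : ℕ) : pk k n = pkTail k 0 n := by
  refine partCount_congr (S := {i | ∃ m : ℕ, i = m ^ k}) fun i hi _ => ?_
  constructor
  · rintro ⟨m, rfl⟩
    exact ⟨m, Nat.pos_of_ne_zero (by rintro rfl; simp [hk] at hi), rfl⟩
  · rintro ⟨m, -, rfl⟩
    exact ⟨m, rfl⟩

theorem powers_diff_singleton {k : ℕ} (hk : k ≠ 0) (M : ℕ) :
    {i | ∃ m, M < m ∧ i = m ^ k} \ {(M + 1) ^ k} = {i | ∃ m, M + 1 < m ∧ i = m ^ k} := by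
  ext i
  constructor
  · rintro ⟨⟨m, hm, rfl⟩, h⟩
    exact ⟨m, lt_of_le_of_ne hm fun h' => h (by rw [← h']; rfl), rfl⟩
  · rintro ⟨m, hm, rfl⟩
    exact ⟨⟨m, by omega, rfl⟩, fun h => by
      have := Nat.pow_left_injective hk h
      omega⟩

theorem pkTail_add {k : ℕ} (hk : k ≠ 0) (M n : ℕ) :
    pkTail k M (n + (M + 1) ^ k) = pkTail k M n + pkTail k (M + 1) (n + (M + 1) ^ k) := by
  unfold pkTail
  have h : (M + 1) ^ k ∈ {i | ∃ m, M < m ∧ i = m ^ k} := ⟨M + 1, by omega, rfl⟩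
  rw [partCount_add h (by positivity), powers_diff_singleton hk]

theorem pkTail_of_lt {k M n : ℕ} (hn : n < (M + 1) ^ k) :
    pkTail k M n = pkTail k (M + 1) n := by
  refine partCount_congr fun i hi hin => ⟨?_, ?_⟩
  · rintro ⟨m, hm, rfl⟩
    exact ⟨m, lt_of_le_of_ne hm fun h => by subst h; omega, rfl⟩
  · rintro ⟨m, hm, rfl⟩
    exact ⟨m, by omega, rfl⟩

theorem pkTail_zero (k M : ℕ) : pkTail k M 0 = 1 := partCount_zero _

theorem pkTail_le (k M n : ℕ) : pkTail k M n ≤ pkTail k 0 n :=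
  partCount_mono (by rintro i ⟨m, hm, h⟩; exact ⟨m, by omega, h⟩) n

theorem pkTail_eq_zero {k M n : ℕ} (hk : k ≠ 0) (hn : 0 < n) (hM : n ≤ M) :
    pkTail k M n = 0 := by
  refine partCount_eq_zero hn ?_
  rintro _ ⟨m, hm, rfl⟩ h
  have := Nat.le_self_pow hk m
  omega

theorem pk_succ {k : ℕ} (hk : k ≠ 0) (n : ℕ) : pk k (n + 1) = pk k n + pkTail k 1 (n + 1) := by
  have := pkTail_add hk 0 n
  simpa [pk_eq_pkTail hk] using this

theorem pk_monotone {k : ℕ} (hk : k ≠ 0) : Monotone (pk k) :=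
  monotone_nat_of_le_succ fun n => by rw [pk_succ hk]; omega

theorem pk_pos {k : ℕ} (hk : k ≠ 0) (n : ℕ) : 0 < pk k n :=
  lt_of_lt_of_le (by rw [pk_eq_pkTail hk, pkTail_zero]; exact one_pos) (pk_monotone hk n.zero_le)

/-- The number of partitions into `k`-th powers larger than `1` is nondecreasing along steps that
are long enough to be sums of copies of `2 ^ k` and `3 ^ k`. -/
theorem exists_pkTail_one_le {k : ℕ} :
    ∃ H, ∀ n m, n + H ≤ m → pkTail k 1 n ≤ pkTail k 1 m := by
  refine ⟨2 ^ k * 3 ^ k, fun n m h => ?_⟩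
  have hc : Nat.Coprime (2 ^ k) (3 ^ k) := Nat.Coprime.pow _ _ (by norm_num)
  obtain ⟨i, j, hij⟩ : ∃ i j, m - n = i * 2 ^ k + j * 3 ^ k := by
    obtain ⟨i, j, hij⟩ := Nat.exists_add_mul_eq_of_gcd_dvd_of_mul_pred_le (2 ^ k) (3 ^ k) (m - n)
      (by rw [hc.gcd_eq_one]; exact one_dvd _)
      ((Nat.mul_le_mul (Nat.pred_le _) (Nat.pred_le _)).trans (by omega))
    exact ⟨i, j, hij.symm⟩
  have hm : m = n + i * 2 ^ k + j * 3 ^ k := by omega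
  rw [hm]
  have h2 : 2 ^ k ∈ {i | ∃ m, 1 < m ∧ i = m ^ k} := ⟨2, by omega, rfl⟩
  have h3 : 3 ^ k ∈ {i | ∃ m, 1 < m ∧ i = m ^ k} := ⟨3, by omega, rfl⟩
  exact (partCount_le_add_mul h2 (by positivity) n i).trans
    (partCount_le_add_mul h3 (by positivity) _ j)

theorem sum_range_pkTail_le {k : ℕ} (hk : k ≠ 0) (M N : ℕ) {r : ℝ} (hr : 0 ≤ r) :
    (∑ n ∈ Finset.range N, (pkTail k M n : ℝ) * r ^ n) * (1 - r ^ ((M + 1) ^ k)) ≤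
      ∑ n ∈ Finset.range N, (pkTail k (M + 1) n : ℝ) * r ^ n := by
  set a := (M + 1) ^ k with ha
  have hnn : ∀ M n, 0 ≤ (pkTail k M n : ℝ) * r ^ n := fun M n => by positivity
  have hlt : ∀ n < a, pkTail k M n = pkTail k (M + 1) n := fun n hn => pkTail_of_lt hn
  rcases le_total N a with h | h
  · have h1 : ∑ n ∈ Finset.range N, (pkTail k M n : ℝ) * r ^ n =
        ∑ n ∈ Finset.range N, (pkTail k (M + 1) n : ℝ) * r ^ n :=
      Finset.sum_congr rfl fun n hn => by rw [hlt n ((Finset.mem_range.1 hn).trans_le h)]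
    rw [h1]
    exact mul_le_of_le_one_right (Finset.sum_nonneg fun n _ => hnn _ n)
      (by linarith [pow_nonneg hr a])
  · obtain ⟨N', rfl⟩ := Nat.exists_eq_add_of_le h
    have h1 : ∑ n ∈ Finset.range (a + N'), (pkTail k M n : ℝ) * r ^ n =
        ∑ n ∈ Finset.range (a + N'), (pkTail k (M + 1) n : ℝ) * r ^ n +
          (∑ n ∈ Finset.range N', (pkTail k M n : ℝ) * r ^ n) * r ^ a := by
      rw [Finset.sum_range_add, Finset.sum_range_add, add_assoc, Finset.sum_mul,
        ← Finset.sum_add_distrib]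
      congr 1
      · exact Finset.sum_congr rfl fun n hn => by rw [hlt n (Finset.mem_range.1 hn)]
      · refine Finset.sum_congr rfl fun n _ => ?_
        rw [add_comm a n, ha, pkTail_add hk]
        push_cast
        ring
    have h2 : ∑ n ∈ Finset.range N', (pkTail k M n : ℝ) * r ^ n ≤
        ∑ n ∈ Finset.range (a + N'), (pkTail k M n : ℝ) * r ^ n :=
      Finset.sum_le_sum_of_subset_of_nonneg (Finset.range_mono (by omega)) fun n _ _ => hnn _ n
    nlinarith [mul_le_mul_of_nonneg_right h2 (pow_nonneg hr a)]

theorem exp_neg_div_le_one_sub {x : ℝ} (hx : x < 1) : Real.exp (-(x / (1 - x))) ≤ 1 - x := by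
  have h : 0 < 1 - x := by linarith
  rw [Real.exp_neg, inv_le_comm₀ (Real.exp_pos _) h]
  calc (1 - x)⁻¹ = x / (1 - x) + 1 := by field_simp; ring
    _ ≤ _ := Real.add_one_le_exp _

theorem exp_le_prod_one_sub {k : ℕ} (hk : k ≠ 0) {r : ℝ} (hr : 0 ≤ r) (hr1 : r < 1) (M : ℕ) :
    Real.exp (-(1 / (1 - r) ^ 2)) ≤ ∏ m ∈ Finset.range M, (1 - r ^ ((m + 1) ^ k)) := by
  have h0 : 0 < 1 - r := by linarith
  have h1 : ∀ m : ℕ, Real.exp (-(r ^ m / (1 - r))) ≤ 1 - r ^ ((m + 1) ^ k) := fun m => by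
    have hle : r ^ ((m + 1) ^ k) ≤ r ^ (m + 1) :=
      pow_le_pow_of_le_one hr hr1.le (Nat.le_self_pow hk _)
    have hle' : r ^ (m + 1) ≤ r := pow_le_of_le_one hr hr1.le (by omega)
    have hle'' : r ^ (m + 1) ≤ r ^ m := pow_le_pow_of_le_one hr hr1.le (by omega)
    refine le_trans ?_ (exp_neg_div_le_one_sub (by linarith))
    exact Real.exp_le_exp.2 (neg_le_neg
      (div_le_div₀ (pow_nonneg hr m) (hle.trans hle'') h0 (by linarith)))
  calc Real.exp (-(1 / (1 - r) ^ 2))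
      ≤ Real.exp (∑ m ∈ Finset.range M, -(r ^ m / (1 - r))) := by
        gcongr
        rw [Finset.sum_neg_distrib, neg_le_neg_iff, ← Finset.sum_div]
        have h2 := (summable_geometric_of_lt_one hr hr1).sum_le_tsum (Finset.range M)
          fun i _ => pow_nonneg hr i
        rw [tsum_geometric_of_lt_one hr hr1] at h2
        calc _ ≤ (1 - r)⁻¹ / (1 - r) := by gcongr
          _ = _ := by field_simp
    _ = ∏ m ∈ Finset.range M, Real.exp (-(r ^ m / (1 - r))) := Real.exp_sum _ _
    _ ≤ _ := Finset.prod_le_prod (fun _ _ => (Real.exp_pos _).le) fun m _ => h1 m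

theorem summable_pkTail {k : ℕ} (hk : k ≠ 0) (M : ℕ) {r : ℝ} (hr : 0 ≤ r) (hr1 : r < 1) :
    Summable fun n => (pkTail k M n : ℝ) * r ^ n := by
  suffices h : Summable fun n => (pkTail k 0 n : ℝ) * r ^ n from
    h.of_nonneg_of_le (fun n => by positivity) fun n => by
      gcongr
      exact pkTail_le k M n
  refine summable_of_sum_range_le (c := Real.exp (1 / (1 - r) ^ 2)) (fun n => by positivity)
    fun N => ?_
  have hP := exp_le_prod_one_sub hk hr hr1
  have h1 : ∀ M, (∑ n ∈ Finset.range N, (pkTail k 0 n : ℝ) * r ^ n) *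
      ∏ m ∈ Finset.range M, (1 - r ^ ((m + 1) ^ k)) ≤
      ∑ n ∈ Finset.range N, (pkTail k M n : ℝ) * r ^ n := by
    intro M
    induction M with
    | zero => simp
    | succ M ih =>
      rw [Finset.prod_range_succ, ← mul_assoc]
      refine le_trans ?_ (sum_range_pkTail_le hk M N hr)
      have : r ^ ((M + 1) ^ k) ≤ 1 := pow_le_one₀ hr hr1.le
      exact mul_le_mul_of_nonneg_right ih (by linarith)
  have h2 : ∑ n ∈ Finset.range N, (pkTail k N n : ℝ) * r ^ n ≤ 1 := by
    refine (Finset.sum_le_sum (g := fun n => if n = 0 then (1 : ℝ) else 0) fun n hn => ?_).trans ?_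
    · rcases Nat.eq_zero_or_pos n with rfl | h
      · simp [pkTail_zero]
      · simp [pkTail_eq_zero hk h (Finset.mem_range.1 hn).le, h.ne']
    · rw [Finset.sum_ite_eq' (Finset.range N) 0 fun _ => (1 : ℝ)]
      split_ifs <;> norm_num
  have h3 : (∑ n ∈ Finset.range N, (pkTail k 0 n : ℝ) * r ^ n) *
      Real.exp (-(1 / (1 - r) ^ 2)) ≤ 1 :=
    (mul_le_mul_of_nonneg_left (hP N) (Finset.sum_nonneg fun n _ => by positivity)).trans
      ((h1 N).trans h2)
  rwa [Real.exp_neg, ← div_eq_mul_inv, div_le_one (Real.exp_pos _)] at h3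

/-- Generating function of the partitions into `k`-th powers of integers larger than `M`. -/
noncomputable def pkGen (k M : ℕ) (z : ℂ) : ℂ := ∑' n, (pkTail k M n : ℂ) * z ^ n

theorem summable_pkTail_complex {k : ℕ} (hk : k ≠ 0) (M : ℕ) {z : ℂ} (hz : ‖z‖ < 1) :
    Summable fun n => (pkTail k M n : ℂ) * z ^ n := by
  refine Summable.of_norm ?_
  simpa using summable_pkTail hk M (norm_nonneg z) hz

theorem pkGen_mul {k : ℕ} (hk : k ≠ 0) (M : ℕ) {z : ℂ} (hz : ‖z‖ < 1) :
    pkGen k M z * (1 - z ^ ((M + 1) ^ k)) = pkGen k (M + 1) z := by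
  have h1 := (summable_pkTail_complex hk M hz).sum_add_tsum_nat_add ((M + 1) ^ k)
  have h2 := (summable_pkTail_complex hk (M + 1) hz).sum_add_tsum_nat_add ((M + 1) ^ k)
  have h3 := (summable_nat_add_iff ((M + 1) ^ k)).2 (summable_pkTail_complex hk (M + 1) hz)
  have h4 := (summable_pkTail_complex hk M hz).mul_right (z ^ ((M + 1) ^ k))
  have h5 : ∑' n, (pkTail k M (n + (M + 1) ^ k) : ℂ) * z ^ (n + (M + 1) ^ k) =
      pkGen k M z * z ^ ((M + 1) ^ k) +
        ∑' n, (pkTail k (M + 1) (n + (M + 1) ^ k) : ℂ) * z ^ (n + (M + 1) ^ k) := by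
    rw [pkGen, ← tsum_mul_right, ← h4.tsum_add h3]
    refine tsum_congr fun n => ?_
    rw [pkTail_add hk]
    push_cast
    ring
  have h6 : ∑ n ∈ Finset.range ((M + 1) ^ k), (pkTail k M n : ℂ) * z ^ n =
      ∑ n ∈ Finset.range ((M + 1) ^ k), (pkTail k (M + 1) n : ℂ) * z ^ n :=
    Finset.sum_congr rfl fun n hn => by rw [pkTail_of_lt (Finset.mem_range.1 hn)]
  rw [h5, h6] at h1
  change _ = pkGen k M z at h1
  change _ = pkGen k (M + 1) z at h2
  linear_combination h2 - h1

theorem pkGen_mul_prod {k : ℕ} (hk : k ≠ 0) (M : ℕ) {z : ℂ} (hz : ‖z‖ < 1) :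
    pkGen k 0 z * ∏ m ∈ Finset.range M, (1 - z ^ ((m + 1) ^ k)) = pkGen k M z := by
  induction M with
  | zero => simp
  | succ M ih => rw [Finset.prod_range_succ, ← mul_assoc, ih, pkGen_mul hk M hz]

theorem tendsto_pkGen {k : ℕ} (hk : k ≠ 0) {z : ℂ} (hz : ‖z‖ < 1) :
    Tendsto (fun M => pkGen k M z) atTop (nhds 1) := by
  have h0 : ∑' n, (if n = 0 then (1 : ℂ) else 0) = 1 := tsum_ite_eq 0 fun _ => (1 : ℂ)
  rw [← h0]
  refine tendsto_tsum_of_dominated_convergence (summable_pkTail hk 0 (norm_nonneg z) hz)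
    (fun n => ?_) (Eventually.of_forall fun M n => ?_)
  · refine tendsto_const_nhds.congr' ?_
    filter_upwards [eventually_ge_atTop n] with M hM
    rcases Nat.eq_zero_or_pos n with rfl | h
    · simp [pkTail_zero]
    · simp [pkTail_eq_zero hk h hM, h.ne']
  · rw [norm_mul, norm_pow, Complex.norm_natCast]
    gcongr
    exact pkTail_le k M n

theorem tendsto_pkGen_mul_prod {k : ℕ} (hk : k ≠ 0) {z : ℂ} (hz : ‖z‖ < 1) :
    Tendsto (fun M => pkGen k 0 z * ∏ m ∈ Finset.range M, (1 - z ^ ((m + 1) ^ k))) atTop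
      (nhds 1) := by
  simpa only [pkGen_mul_prod hk _ hz] using tendsto_pkGen hk hz

theorem pkGen_ne_zero {k : ℕ} (hk : k ≠ 0) {z : ℂ} (hz : ‖z‖ < 1) : pkGen k 0 z ≠ 0 := by
  intro h
  have := tendsto_pkGen_mul_prod hk hz
  simp only [h, zero_mul] at this
  exact zero_ne_one (tendsto_nhds_unique tendsto_const_nhds this)

theorem tendsto_prod_div_pkGen {k : ℕ} (hk : k ≠ 0) {z w : ℂ} (hz : ‖z‖ < 1) (hw : ‖w‖ < 1) :
    Tendsto (fun M => ∏ m ∈ Finset.range M, (1 - w ^ ((m + 1) ^ k)) / (1 - z ^ ((m + 1) ^ k)))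
      atTop (nhds (pkGen k 0 z / pkGen k 0 w)) := by
  have h := ((tendsto_pkGen_mul_prod hk hw).div (tendsto_pkGen_mul_prod hk hz)
    one_ne_zero).const_mul (pkGen k 0 z / pkGen k 0 w)
  rw [div_one, mul_one] at h
  refine h.congr fun M => ?_
  have h1 := pkGen_ne_zero hk hz
  have h2 := pkGen_ne_zero hk hw
  simp only [Pi.div_apply]
  rw [Finset.prod_div_distrib, mul_div_mul_comm, ← mul_assoc, div_mul_div_comm,
    mul_comm (pkGen k 0 w), div_self (mul_ne_zero h1 h2), one_mul]

theorem norm_exp_mul_I_sub_taylor_two_le (t : ℝ) :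
    ‖cexp (t * I) - (1 + t * I - t ^ 2 / 2)‖ ≤ 4 * |t| ^ 3 := by
  rcases le_total |t| 1 with h | h
  · have hn : ‖(t : ℂ) * I‖ = |t| := by simp
    have h1 := Complex.exp_bound (x := t * I) (by rw [hn]; exact h) (n := 3) (by norm_num)
    rw [hn] at h1
    have h2 : ∑ m ∈ Finset.range 3, ((t : ℂ) * I) ^ m / (m.factorial : ℂ) =
        1 + t * I - t ^ 2 / 2 := by
      simp only [Finset.sum_range_succ, Finset.sum_range_zero, Nat.factorial]
      push_cast
      linear_combination (t : ℂ) ^ 2 / 2 * I_sq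
    rw [h2] at h1
    refine h1.trans ?_
    rw [mul_comm]
    gcongr
    norm_num [Nat.factorial]
  · have h1 : ‖cexp (t * I)‖ = 1 := Complex.norm_exp_ofReal_mul_I t
    have h2 : ‖(t : ℂ) * I‖ = |t| := by simp
    have h3 : ‖(t : ℂ) ^ 2 / 2‖ = |t| ^ 2 / 2 := by simp
    have h4 := norm_sub_le (cexp (t * I)) (1 + t * I - t ^ 2 / 2)
    have h5 := norm_sub_le (1 + t * I : ℂ) (t ^ 2 / 2)
    have h6 := norm_add_le (1 : ℂ) (t * I)
    rw [h1] at h4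
    rw [h3] at h5
    rw [h2, norm_one] at h6
    nlinarith [mul_le_mul h h (by norm_num) (by positivity), pow_le_pow_right₀ h (show 1 ≤ 3 by norm_num),
      pow_le_pow_right₀ h (show 2 ≤ 3 by norm_num), pow_le_pow_right₀ h (show 0 ≤ 3 by norm_num)]

/-- The characteristic function of a geometric random variable of ratio `exp (-x)`. -/
noncomputable def geomChar (x φ : ℝ) : ℂ := (1 - Real.exp (-x)) / (1 - cexp (-x + φ * I))

theorem norm_cexp_neg_add (x φ : ℝ) : ‖cexp (-x + φ * I)‖ = Real.exp (-x) := by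
  rw [Complex.norm_exp]
  simp

theorem norm_one_sub_exp_neg {x : ℝ} (hx : 0 < x) :
    ‖(1 - Real.exp (-x) : ℂ)‖ = 1 - Real.exp (-x) := by
  have : Real.exp (-x) < 1 := by simpa using hx
  rw [← Complex.ofReal_one, ← Complex.ofReal_sub, Complex.norm_real, Real.norm_eq_abs, abs_of_pos]
  linarith

theorem one_sub_exp_le_norm {x : ℝ} (φ : ℝ) :
    1 - Real.exp (-x) ≤ ‖1 - cexp (-x + φ * I)‖ := by
  have := norm_sub_norm_le 1 (cexp (-x + φ * I))
  rwa [norm_cexp_neg_add, norm_one] at this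

theorem norm_geomChar_le_one {x : ℝ} (hx : 0 < x) (φ : ℝ) : ‖geomChar x φ‖ ≤ 1 := by
  rw [geomChar, norm_div, norm_one_sub_exp_neg hx]
  exact div_le_one_of_le₀ (one_sub_exp_le_norm φ) (norm_nonneg _)

theorem norm_one_sub_cexp_sq (x φ : ℝ) : ‖1 - cexp (-x + φ * I)‖ ^ 2 =
    (1 - Real.exp (-x)) ^ 2 + 2 * Real.exp (-x) * (1 - Real.cos φ) := by
  have h : -(x : ℂ) + φ * I = ((-x : ℝ) : ℂ) + φ * I := by push_cast; ring
  rw [← Complex.normSq_eq_norm_sq, Complex.normSq_apply, h]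
  simp only [Complex.sub_re, Complex.one_re, Complex.exp_re, Complex.sub_im, Complex.one_im,
    Complex.exp_im]
  simp
  linear_combination (Real.exp (-x)) ^ 2 * Real.sin_sq_add_cos_sq φ

theorem norm_geomChar_sq_le {x u : ℝ} (hx : 0 < x) (hx1 : x ≤ 1) (hu : |x * u| ≤ 1) :
    ‖geomChar x (x * u)‖ ^ 2 ≤ (1 + u ^ 2 / 8)⁻¹ := by
  rw [geomChar, norm_div, norm_one_sub_exp_neg hx, div_pow, norm_one_sub_cexp_sq]
  have h1 := Real.cos_le_one_sub_mul_cos_sq (x := x * u) (hu.trans (by linarith [Real.pi_gt_three]))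
  have h2 : Real.exp (-x) < 1 := by simpa using hx
  have h3 : 1 - Real.exp (-x) ≤ x := by linarith [Real.add_one_le_exp (-x)]
  have h4 : (1 / 2.7182818286 : ℝ) ≤ Real.exp (-x) := by
    refine le_trans ?_ (Real.exp_le_exp.2 (neg_le_neg hx1))
    rw [Real.exp_neg, one_div]
    exact inv_anti₀ (Real.exp_pos _) Real.exp_one_lt_d9.le
  have h5 : (1 / 10 : ℝ) ≤ 1 / π ^ 2 := by
    refine one_div_le_one_div_of_le (by positivity) ?_
    nlinarith [Real.pi_lt_d2, Real.pi_pos]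
  have h6 : (1 / 5 : ℝ) * (x * u) ^ 2 ≤ 1 - Real.cos (x * u) := by
    have : 2 / π ^ 2 * (x * u) ^ 2 = 2 * (1 / π ^ 2) * (x * u) ^ 2 := by ring
    nlinarith [sq_nonneg (x * u)]
  have h7 : (x * u) ^ 2 / 8 ≤ 2 * Real.exp (-x) * (1 - Real.cos (x * u)) := by
    calc (x * u) ^ 2 / 8 ≤ 2 * (1 / 2.7182818286) * (1 / 5 * (x * u) ^ 2) := by
          nlinarith [sq_nonneg (x * u)]
      _ ≤ _ := by gcongr
  have h8 : 0 < (1 - Real.exp (-x)) ^ 2 := by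
    have : 0 < 1 - Real.exp (-x) := by linarith
    positivity
  have h9 : (1 - Real.exp (-x)) ^ 2 ≤ x ^ 2 := by
    have : 0 < 1 - Real.exp (-x) := by linarith
    gcongr
  rw [← one_div, div_le_div_iff₀ (by linarith [div_nonneg (sq_nonneg (x * u)) (by norm_num : (0:ℝ) ≤ 8)]) (by positivity)]
  have h10 := mul_le_mul_of_nonneg_right h9 (div_nonneg (sq_nonneg u) (by norm_num : (0:ℝ) ≤ 8))
  nlinarith

theorem norm_log_series_term_le {ρ : ℝ} (hρ0 : 0 ≤ ρ) (φ : ℝ) {w : ℂ} (l : ℕ)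
    (hw : w ^ (l + 1) = (ρ : ℂ) ^ (l + 1) * cexp ((((l + 1 : ℕ) : ℝ) * φ : ℝ) * I)) :
    ‖w ^ (l + 1) / ((l + 1 : ℕ) : ℂ) - (ρ : ℂ) ^ (l + 1) / ((l + 1 : ℕ) : ℂ) -
        φ * I * (ρ : ℂ) ^ (l + 1) + (φ : ℂ) ^ 2 / 2 * (((l + 1 : ℕ) : ℂ) * (ρ : ℂ) ^ (l + 1))‖ ≤
      8 * |φ| ^ 3 * ρ * (((l + 2).choose 2 : ℕ) * ρ ^ l) := by
  have h1 : w ^ (l + 1) / ((l + 1 : ℕ) : ℂ) - (ρ : ℂ) ^ (l + 1) / ((l + 1 : ℕ) : ℂ) -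
        φ * I * (ρ : ℂ) ^ (l + 1) + (φ : ℂ) ^ 2 / 2 * (((l + 1 : ℕ) : ℂ) * (ρ : ℂ) ^ (l + 1)) =
        (ρ : ℂ) ^ (l + 1) / ((l + 1 : ℕ) : ℂ) * (cexp ((((l + 1 : ℕ) : ℝ) * φ : ℝ) * I) -
          (1 + (((l + 1 : ℕ) : ℝ) * φ : ℝ) * I - ((((l + 1 : ℕ) : ℝ) * φ : ℝ) : ℂ) ^ 2 / 2)) := by
    rw [hw]
    generalize cexp ((((l + 1 : ℕ) : ℝ) * φ : ℝ) * I) = E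
    have : ((l : ℂ) + 1) ≠ 0 := by exact_mod_cast l.succ_ne_zero
    push_cast
    field_simp
    ring
  rw [h1, norm_mul, norm_div, norm_pow, Complex.norm_real, Complex.norm_natCast,
    Real.norm_eq_abs, abs_of_nonneg hρ0]
  refine (mul_le_mul_of_nonneg_left (norm_exp_mul_I_sub_taylor_two_le _) (by positivity)).trans ?_
  have h2 : (((l + 2).choose 2 : ℕ) : ℝ) = (l + 2) * (l + 1) / 2 := by
    rw [Nat.cast_choose_two]
    push_cast
    ring
  rw [h2, abs_mul, Nat.abs_cast]
  push_cast
  have h3 : ρ ^ (l + 1) / ((l : ℝ) + 1) * (4 * (((l : ℝ) + 1) * |φ|) ^ 3) =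
      4 * |φ| ^ 3 * ρ * (((l : ℝ) + 1) * ρ ^ l) * (l + 1) := by
    field_simp
    ring
  rw [h3]
  calc _ ≤ 4 * |φ| ^ 3 * ρ * (((l : ℝ) + 1) * ρ ^ l) * (l + 2) := by gcongr; norm_num
    _ = _ := by ring

theorem geomChar_eq_cexp {x : ℝ} (hx : 0 < x) (φ : ℝ) :
    ∃ e : ℂ, geomChar x φ = cexp (φ * (Real.exp (-x) / (1 - Real.exp (-x)) : ℝ) * I -
      φ ^ 2 / 2 * (Real.exp (-x) / (1 - Real.exp (-x)) ^ 2 : ℝ) + e) ∧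
      ‖e‖ ≤ 8 * |φ| ^ 3 * (Real.exp (-x) / (1 - Real.exp (-x)) ^ 3) := by
  set ρ := Real.exp (-x) with hρ
  have hρ0 : 0 < ρ := Real.exp_pos _
  have hρ1 : ρ < 1 := by simpa [hρ] using hx
  have hn : ‖(ρ : ℂ)‖ < 1 := by simpa [abs_of_pos hρ0] using hρ1
  set w := cexp (-x + φ * I) with hw
  have hgw : geomChar x φ = (1 - ρ) / (1 - w) := rfl
  have hwρ : ∀ l : ℕ, w ^ l = (ρ : ℂ) ^ l * cexp ((l * φ : ℝ) * I) := fun l => by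
    rw [hw, Complex.exp_add, mul_pow, ← Complex.exp_nat_mul (φ * I), hρ]
    push_cast
    ring_nf
  have hwn : ‖w‖ < 1 := by rw [hw, norm_cexp_neg_add]; exact hρ1
  have s1 := Complex.hasSum_taylorSeries_neg_log hwn
  have s2 := Complex.hasSum_taylorSeries_neg_log hn
  have s1' := (hasSum_nat_add_iff' 1).2 s1
  have s2' := (hasSum_nat_add_iff' 1).2 s2
  have s3 : HasSum (fun l : ℕ => (ρ : ℂ) ^ (l + 1)) (ρ / (1 - ρ)) := by
    simpa [pow_succ', div_eq_mul_inv] using (hasSum_geometric_of_norm_lt_one hn).mul_left (ρ : ℂ)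
  have s4 : HasSum (fun l : ℕ => (l : ℂ) * (ρ : ℂ) ^ l) (ρ / (1 - ρ) ^ 2) :=
    hasSum_coe_mul_geometric_of_norm_lt_one hn
  have s4' := (hasSum_nat_add_iff' 1).2 s4
  simp only [Finset.range_one, Finset.sum_singleton, pow_zero, Nat.cast_zero, div_zero, sub_zero,
    zero_mul] at s1' s2' s4'
  have s5 := ((s1'.sub s2').sub (s3.mul_left (φ * I))).add (s4'.mul_left ((φ : ℂ) ^ 2 / 2))
  have s6 := ((hasSum_choose_mul_geometric_of_norm_lt_one 2
    (r := ρ) (by simpa [abs_of_pos hρ0] using hρ1)).mul_left (8 * |φ| ^ 3 * ρ))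
  refine ⟨-Complex.log (1 - w) - -Complex.log (1 - ρ) - φ * I * (ρ / (1 - ρ)) +
    φ ^ 2 / 2 * (ρ / (1 - ρ) ^ 2), ?_, ?_⟩
  · have h1 : (1 - ρ : ℂ) ≠ 0 := by
      rw [sub_ne_zero]
      intro h
      rw [← h] at hn
      simp at hn
    have h2 : (1 - w : ℂ) ≠ 0 := by
      rw [sub_ne_zero]
      intro h
      rw [← h] at hwn
      simp at hwn
    rw [hgw]
    nth_rewrite 1 [← Complex.exp_log h1]
    nth_rewrite 1 [← Complex.exp_log h2]
    rw [← Complex.exp_sub]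
    congr 1
    push_cast
    ring
  · rw [← s5.tsum_eq]
    refine (tsum_of_norm_bounded s6 fun l =>
      norm_log_series_term_le hρ0.le φ l (hwρ (l + 1))).trans (le_of_eq ?_)
    norm_num
    ring

theorem summable_exp_neg_powers_and_tsum_le {k : ℕ} (hk : k ≠ 0) {b : ℝ} (hb : 0 < b) :
    Summable (fun m : ℕ => Real.exp (-(b * ((m + 1 : ℕ) : ℝ) ^ k))) ∧
    ∑' m : ℕ, Real.exp (-(b * ((m + 1 : ℕ) : ℝ) ^ k)) ≤
      b ^ (-(k : ℝ)⁻¹) * Real.Gamma (1 / k + 1) := by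
  have hk0 : (0 : ℝ) < k := by positivity
  set f : ℝ → ℝ := fun t => Real.exp (-b * t ^ (k : ℝ)) with hf
  have anti : AntitoneOn f (Set.Ici 0) := by
    intro s hs t ht hst
    have : s ^ (k : ℝ) ≤ t ^ (k : ℝ) := Real.rpow_le_rpow hs hst hk0.le
    refine Real.exp_le_exp.2 ?_
    nlinarith
  have hf_int : MeasureTheory.IntegrableOn f (Set.Ioi 0) := by
    have := integrableOn_rpow_mul_exp_neg_mul_rpow (s := 0) (by norm_num) hk0 hb
    simpa [hf] using this
  have hnn : ∀ t ∈ Set.Ioi (0 : ℝ), 0 ≤ f t := fun t _ => (Real.exp_pos _).le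
  have hterm : ∀ m : ℕ, f ((m + 1 : ℕ) : ℝ) = Real.exp (-(b * ((m + 1 : ℕ) : ℝ) ^ k)) :=
    fun m => by simp only [hf, Real.rpow_natCast, neg_mul]
  have h1 := anti.summable_of_integrableOn_Ioi_zero hf_int hnn
  have h2 := anti.tsum_add_one_le_integral hf_int hnn
  rw [integral_exp_neg_mul_rpow hk0 hb] at h2
  have h3 := (summable_nat_add_iff 1).2 h1
  simp only [hterm] at h2 h3
  refine ⟨h3, h2.trans (le_of_eq ?_)⟩
  rw [neg_div, one_div]

theorem pow_div_one_sub_exp_le {y : ℝ} (hy : 0 < y) {i : ℕ} (hi : i ≤ 3) :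
    y ^ i * (Real.exp (-y) / (1 - Real.exp (-y)) ^ i) ≤ 216 * Real.exp (-(y / 2)) := by
  have h1 : Real.exp (-y) < 1 := by simpa using hy
  have h2 : y / (1 - Real.exp (-y)) ≤ 1 + y := by
    rw [div_le_iff₀ (by linarith)]
    have : Real.exp (-y) * (1 + y) ≤ 1 := by
      calc Real.exp (-y) * (1 + y) ≤ Real.exp (-y) * Real.exp y := by
            gcongr
            linarith [Real.add_one_le_exp y]
        _ = 1 := by rw [← Real.exp_add]; simp
    linarith
  have h0 : 0 ≤ y / (1 - Real.exp (-y)) := div_nonneg hy.le (by linarith)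
  have h3 : (y / (1 - Real.exp (-y))) ^ i ≤ (1 + y) ^ 3 :=
    (pow_le_pow_left₀ h0 h2 i).trans (pow_le_pow_right₀ (by linarith) hi)
  have h4 : (1 + y) ^ 3 ≤ 216 * Real.exp (y / 2) := by
    have h5 : 1 + y ≤ 6 * Real.exp (y / 6) := by linarith [Real.add_one_le_exp (y / 6)]
    calc (1 + y) ^ 3 ≤ (6 * Real.exp (y / 6)) ^ 3 := by gcongr
      _ = 216 * Real.exp (y / 2) := by
        rw [mul_pow, ← Real.exp_nat_mul]
        norm_num
        ring_nf
  calc y ^ i * (Real.exp (-y) / (1 - Real.exp (-y)) ^ i)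
      = (y / (1 - Real.exp (-y))) ^ i * Real.exp (-y) := by rw [div_pow]; ring
    _ ≤ 216 * Real.exp (y / 2) * Real.exp (-y) := by gcongr; exact h3.trans h4
    _ = 216 * Real.exp (-(y / 2)) := by
      rw [mul_assoc, ← Real.exp_add]
      ring_nf

/-- For `i = 1, 2`, the mean and variance of the partition size in the Boltzmann model of
partitions into `k`-th powers with parameter `σ`, measured in units of `1 / σ`; for `i = 3`, a bound
for the third cumulants. -/
noncomputable def cumulantTerm (k : ℕ) (σ : ℝ) (i m : ℕ) : ℝ :=
  (σ * ((m + 1 : ℕ) : ℝ) ^ k) ^ i * (Real.exp (-(σ * ((m + 1 : ℕ) : ℝ) ^ k)) /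
    (1 - Real.exp (-(σ * ((m + 1 : ℕ) : ℝ) ^ k))) ^ i)

theorem cumulantTerm_nonneg (k : ℕ) {σ : ℝ} (hσ : 0 < σ) (i m : ℕ) : 0 ≤ cumulantTerm k σ i m := by
  have hx : 0 < σ * ((m + 1 : ℕ) : ℝ) ^ k := by positivity
  have h1 : Real.exp (-(σ * ((m + 1 : ℕ) : ℝ) ^ k)) < 1 := by simpa using hx
  have h2 : 0 < 1 - Real.exp (-(σ * ((m + 1 : ℕ) : ℝ) ^ k)) := by linarith
  unfold cumulantTerm
  positivity

theorem summable_cumulantTerm {k : ℕ} (hk : k ≠ 0) {σ : ℝ} (hσ : 0 < σ) {i : ℕ} (hi : i ≤ 3) :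
    Summable (cumulantTerm k σ i) := by
  have h := (summable_exp_neg_powers_and_tsum_le hk (half_pos hσ)).1.mul_left 216
  refine h.of_nonneg_of_le (fun m => cumulantTerm_nonneg k hσ i m) fun m => ?_
  have := pow_div_one_sub_exp_le (y := σ * ((m + 1 : ℕ) : ℝ) ^ k) (by positivity) hi
  rwa [mul_div_right_comm] at this

theorem exists_tsum_cumulantTerm_le {k : ℕ} (hk : k ≠ 0) : ∃ C, 0 < C ∧ ∀ σ : ℝ, 0 < σ → ∀ i ≤ 3,
    ∑' m, cumulantTerm k σ i m ≤ C * σ ^ (-(k : ℝ)⁻¹) := by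
  refine ⟨216 * ((1 / 2) ^ (-(k : ℝ)⁻¹) * Real.Gamma (1 / k + 1)), ?_, fun σ hσ i hi => ?_⟩
  · have := Real.Gamma_pos_of_pos (s := 1 / k + 1) (by positivity)
    positivity
  · have h := summable_exp_neg_powers_and_tsum_le hk (half_pos hσ)
    calc ∑' m, cumulantTerm k σ i m
        ≤ ∑' m : ℕ, 216 * Real.exp (-(σ / 2 * ((m + 1 : ℕ) : ℝ) ^ k)) := by
          refine (summable_cumulantTerm hk hσ hi).tsum_le_tsum (fun m => ?_) (h.1.mul_left 216)
          have := pow_div_one_sub_exp_le (y := σ * ((m + 1 : ℕ) : ℝ) ^ k) (by positivity) hi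
          rwa [mul_div_right_comm] at this
      _ ≤ 216 * ((σ / 2) ^ (-(k : ℝ)⁻¹) * Real.Gamma (1 / k + 1)) := by
          rw [tsum_mul_left]
          gcongr
          exact h.2
      _ = _ := by
          rw [div_eq_mul_one_div, Real.mul_rpow hσ.le (by norm_num)]
          ring

theorem exp_neg_one_mul_le_tsum_cumulantTerm {k : ℕ} (hk : k ≠ 0) {σ : ℝ} (hσ : 0 < σ) {N : ℕ}
    (hN : σ * (N : ℝ) ^ k ≤ 1) : Real.exp (-1) * N ≤ ∑' m, cumulantTerm k σ 2 m := by
  refine le_trans ?_ ((summable_cumulantTerm hk hσ (by norm_num)).sum_le_tsum (Finset.range N)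
    fun m _ => cumulantTerm_nonneg k hσ 2 m)
  have : ∀ m ∈ Finset.range N, Real.exp (-1) ≤ cumulantTerm k σ 2 m := by
    intro m hm
    have hm' : m + 1 ≤ N := Finset.mem_range.1 hm
    unfold cumulantTerm
    have hx : 0 < σ * ((m + 1 : ℕ) : ℝ) ^ k := by positivity
    have hx1 : σ * ((m + 1 : ℕ) : ℝ) ^ k ≤ 1 := le_trans (by gcongr) hN
    generalize σ * ((m + 1 : ℕ) : ℝ) ^ k = x at hx hx1
    have h1 : Real.exp (-x) < 1 := by simpa using hx
    have h2 : 1 - Real.exp (-x) ≤ x := by linarith [Real.add_one_le_exp (-x)]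
    have h3 : 0 < 1 - Real.exp (-x) := by linarith
    rw [← mul_div_assoc, le_div_iff₀ (by positivity)]
    calc Real.exp (-1) * (1 - Real.exp (-x)) ^ 2 ≤ Real.exp (-x) * x ^ 2 := by gcongr
      _ = _ := mul_comm _ _
  have h := Finset.sum_le_sum this
  rw [Finset.sum_const, Finset.card_range, nsmul_eq_mul] at h
  linarith

/-- The continuous extension of `y / (exp y - 1)`. -/
noncomputable def boseFactor (y : ℝ) : ℝ :=
  if y = 0 then 1 else y * (Real.exp (-y) / (1 - Real.exp (-y)))

theorem boseFactor_of_ne {y : ℝ} (hy : y ≠ 0) : boseFactor y = y / (Real.exp y - 1) := by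
  have h : Real.exp y - 1 ≠ 0 := by
    rw [sub_ne_zero]
    simpa using hy
  have h' : 1 - (Real.exp y)⁻¹ ≠ 0 := by
    rw [sub_ne_zero, ne_comm, ne_eq, inv_eq_one]
    simpa using hy
  rw [boseFactor, if_neg hy, Real.exp_neg]
  field_simp

theorem boseFactor_antitoneOn : AntitoneOn boseFactor (Set.Ici 0) := by
  intro a ha b hb hab
  rcases hab.eq_or_lt with rfl | hab
  · rfl
  have hb0 : 0 < b := lt_of_le_of_lt ha hab
  have hb1 : 0 < Real.exp b - 1 := by linarith [Real.add_one_lt_exp hb0.ne']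
  rw [boseFactor_of_ne hb0.ne']
  rcases (show (0 : ℝ) ≤ a from ha).eq_or_lt with rfl | ha0
  · rw [boseFactor, if_pos rfl, div_le_one hb1]
    linarith [Real.add_one_le_exp b]
  · have ha1 : 0 < Real.exp a - 1 := by linarith [Real.add_one_lt_exp ha0.ne']
    rw [boseFactor_of_ne ha0.ne', div_le_div_iff₀ hb1 ha1]
    have h5 : 0 ≤ 1 - a / b := by rw [sub_nonneg, div_le_one hb0]; exact hab.le
    have h6 : 0 ≤ a / b := by positivity
    have h := convexOn_exp.2 (Set.mem_univ 0) (Set.mem_univ b) h5 h6 (by ring)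
    simp only [smul_eq_mul, mul_zero, zero_add, Real.exp_zero, mul_one] at h
    rw [div_mul_cancel₀ _ hb0.ne'] at h
    have h2 := mul_le_mul_of_nonneg_left h hb0.le
    have h3 : b * (1 - a / b + a / b * Real.exp b) = b - a + a * Real.exp b := by
      field_simp
    rw [h3] at h2
    linarith

theorem boseFactor_nonneg {y : ℝ} (hy : 0 ≤ y) : 0 ≤ boseFactor y := by
  rcases hy.eq_or_lt with rfl | h
  · simp [boseFactor]
  · rw [boseFactor_of_ne h.ne']
    exact div_nonneg hy (by linarith [Real.add_one_le_exp y])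

theorem hasSum_zetaR {s : ℝ} (hs : 1 < s) :
    HasSum (fun l : ℕ => ((l : ℝ) + 1) ^ (-s)) (zetaR s) := by
  have h1 := zeta_eq_tsum_one_div_nat_add_one_cpow (s := (s : ℂ)) (by simpa using hs)
  have h2 : ∀ n : ℕ, 1 / ((n : ℂ) + 1) ^ (s : ℂ) = ((((n : ℝ) + 1) ^ (-s) : ℝ) : ℂ) := fun n => by
    rw [Complex.ofReal_cpow (by positivity)]
    push_cast
    rw [Complex.cpow_neg, one_div]
  simp only [h2] at h1
  rw [← Complex.ofReal_tsum] at h1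
  rw [zetaR, h1, Complex.ofReal_re]
  have h3 := (summable_nat_add_iff 1).2 (Real.summable_nat_rpow.2 (neg_lt_neg hs))
  exact (by simpa using h3 : Summable fun l : ℕ => ((l : ℝ) + 1) ^ (-s)).hasSum

theorem integral_boseFactor {k : ℕ} (hk : k ≠ 0) {σ : ℝ} (hσ : 0 < σ) :
    ∫ t in Set.Ioi (0 : ℝ), boseFactor (σ * t ^ k) =
      (1 / (k : ℝ) ^ 2) * zetaR (((k : ℝ) + 1) / k) * Real.Gamma (1 / k) * σ ^ (-(k : ℝ)⁻¹) := by
  have hk0 : (0 : ℝ) < k := by positivity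
  set F : ℕ → ℝ → ℝ := fun l t => σ * (t ^ (k : ℝ) * Real.exp (-((l + 1) * σ) * t ^ (k : ℝ))) with hF
  have hb : ∀ l : ℕ, (0 : ℝ) < (l + 1) * σ := fun l => by positivity
  have hI : ∀ l, ∫ t in Set.Ioi (0 : ℝ), F l t =
      (1 / (k : ℝ) ^ 2) * Real.Gamma (1 / k) * σ ^ (-(k : ℝ)⁻¹) *
        ((l : ℝ) + 1) ^ (-(((k : ℝ) + 1) / k)) := fun l => by
    rw [MeasureTheory.integral_const_mul,
      integral_rpow_mul_exp_neg_mul_rpow hk0 (by linarith) (hb l),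
      Real.mul_rpow (by positivity) hσ.le, neg_div]
    have h1 : ((k : ℝ) + 1) / k = 1 / k + 1 := by rw [add_div, div_self hk0.ne', add_comm]
    have h2 : Real.Gamma (((k : ℝ) + 1) / k) = 1 / k * Real.Gamma (1 / k) := by
      rw [h1, Real.Gamma_add_one (by positivity)]
    have h3 : σ ^ (-(((k : ℝ) + 1) / k)) * σ = σ ^ (-(k : ℝ)⁻¹) := by
      nth_rewrite 2 [← Real.rpow_one σ]
      rw [← Real.rpow_add hσ, h1]
      congr 1
      ring
    rw [h2, ← h3]
    ring
  have hf_int : ∀ l, MeasureTheory.IntegrableOn (F l) (Set.Ioi 0) := fun l =>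
    (integrableOn_rpow_mul_exp_neg_mul_rpow (by linarith) hk0 (hb l)).const_mul σ
  have hnn : ∀ l, ∀ t ∈ Set.Ioi (0 : ℝ), ‖F l t‖ = F l t := fun l t ht => by
    have : 0 < t := ht
    exact Real.norm_of_nonneg (by simp only [hF]; positivity)
  have hz := (hasSum_zetaR (s := ((k : ℝ) + 1) / k) (by rw [one_lt_div hk0]; linarith)).mul_left
    ((1 / (k : ℝ) ^ 2) * Real.Gamma (1 / k) * σ ^ (-(k : ℝ)⁻¹))
  have h := MeasureTheory.hasSum_integral_of_summable_integral_norm hf_int (by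
    simp only [MeasureTheory.setIntegral_congr_fun measurableSet_Ioi (hnn _), hI]
    exact hz.summable)
  simp only [hI] at h
  have h4 := h.unique hz
  rw [show (1 / (k : ℝ) ^ 2) * zetaR (((k : ℝ) + 1) / k) * Real.Gamma (1 / k) * σ ^ (-(k : ℝ)⁻¹) =
    (1 / (k : ℝ) ^ 2) * Real.Gamma (1 / k) * σ ^ (-(k : ℝ)⁻¹) * zetaR (((k : ℝ) + 1) / k) by ring,
    ← h4]
  refine MeasureTheory.setIntegral_congr_fun measurableSet_Ioi fun t ht => ?_
  have ht0 : (0 : ℝ) < t := ht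
  have hx : 0 < σ * t ^ k := by positivity
  have hx1 : Real.exp (-(σ * t ^ k)) < 1 := by simpa using hx
  have hs := (hasSum_geometric_of_lt_one (Real.exp_pos _).le hx1).mul_left
    (σ * t ^ k * Real.exp (-(σ * t ^ k)))
  simp only [boseFactor, if_neg hx.ne']
  rw [← mul_div_assoc, div_eq_mul_inv, ← hs.tsum_eq]
  refine tsum_congr fun l => ?_
  simp only [hF, Real.rpow_natCast]
  rw [mul_assoc, mul_assoc, ← Real.exp_nat_mul, ← Real.exp_add]
  ring_nf

theorem abs_tsum_cumulantTerm_one_sub_le {k : ℕ} (hk : k ≠ 0) {σ : ℝ} (hσ : 0 < σ) :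
    |∑' m, cumulantTerm k σ 1 m -
      (1 / (k : ℝ) ^ 2) * zetaR (((k : ℝ) + 1) / k) * Real.Gamma (1 / k) * σ ^ (-(k : ℝ)⁻¹)| ≤ 1 := by
  rw [← integral_boseFactor hk hσ]
  set f : ℝ → ℝ := fun t => boseFactor (σ * t ^ k) with hf
  have anti : AntitoneOn f (Set.Ici 0) := fun s hs t ht hst => by
    have hs' : (0 : ℝ) ≤ s := hs
    have ht' : (0 : ℝ) ≤ t := ht
    refine boseFactor_antitoneOn (show 0 ≤ σ * s ^ k by positivity)
      (show 0 ≤ σ * t ^ k by positivity) ?_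
    gcongr
  have hnn : ∀ t ∈ Set.Ioi (0 : ℝ), 0 ≤ f t := fun t ht =>
    boseFactor_nonneg (mul_nonneg hσ.le (pow_nonneg (le_of_lt ht) _))
  have hterm : ∀ m : ℕ, f ((m + 1 : ℕ) : ℝ) = cumulantTerm k σ 1 m := fun m => by
    have hx : σ * ((m + 1 : ℕ) : ℝ) ^ k ≠ 0 := by positivity
    simp only [hf, boseFactor, if_neg hx, cumulantTerm, pow_one]
  have hs1 : Summable fun m : ℕ => f ((m + 1 : ℕ) : ℝ) := by
    simp only [hterm]
    exact summable_cumulantTerm hk hσ (by norm_num)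
  have hs : Summable fun m : ℕ => f (m : ℝ) := (summable_nat_add_iff 1).1 hs1
  have h1 := anti.tsum_add_one_le_integral (anti.integrableOn_Ioi_zero_of_summable hs hnn) hnn
  have h2 := anti.integral_le_tsum hs hnn
  rw [hs.tsum_eq_zero_add] at h2
  have h0 : f ((0 : ℕ) : ℝ) = 1 := by simp [hf, boseFactor, hk]
  rw [h0] at h2
  simp only [hterm] at h1 h2
  rw [abs_le]
  constructor <;> linarith

/-- The characteristic function of `σ` times the size of a partition into `k`-th powers chosen
according to the Boltzmann distribution with parameter `σ`. -/
noncomputable def pkRatio (k : ℕ) (σ u : ℝ) : ℂ :=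
  pkGen k 0 (cexp (-σ + σ * u * I)) / pkGen k 0 (cexp (-σ))

theorem tendsto_prod_geomChar {k : ℕ} (hk : k ≠ 0) {σ : ℝ} (hσ : 0 < σ) (u : ℝ) :
    Tendsto (fun M => ∏ m ∈ Finset.range M,
      geomChar (σ * ((m + 1 : ℕ) : ℝ) ^ k) (σ * ((m + 1 : ℕ) : ℝ) ^ k * u)) atTop
      (nhds (pkRatio k σ u)) := by
  have h1 : ‖cexp (-σ + σ * u * I)‖ < 1 := by
    rw [Complex.norm_exp]
    simpa using hσ
  have h2 : ‖cexp (-σ)‖ < 1 := by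
    rw [Complex.norm_exp]
    simpa using hσ
  refine (tendsto_prod_div_pkGen hk h1 h2).congr fun M => ?_
  refine Finset.prod_congr rfl fun m _ => ?_
  rw [geomChar, ← Complex.exp_nat_mul, ← Complex.exp_nat_mul]
  push_cast
  congr 3 <;> ring_nf

theorem norm_pkRatio_le_of_mul_le {k : ℕ} (hk : k ≠ 0) {σ : ℝ} (hσ : 0 < σ) (u : ℝ) {N : ℕ}
    (hN : max 1 |u| * σ * (2 * (N : ℝ)) ^ k ≤ 1) :
    ‖pkRatio k σ u‖ ≤ (1 + N * (u ^ 2 / 8))⁻¹ := by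
  have hB : (1 + N * (u ^ 2 / 8)) ≤ (1 + u ^ 2 / 8) ^ N :=
    one_add_mul_le_pow (by linarith [sq_nonneg u]) N
  have hq : (0 : ℝ) < 1 + u ^ 2 / 8 := by positivity
  refine le_trans ?_ (inv_anti₀ (by positivity) hB)
  rw [← inv_pow]
  refine le_of_tendsto (tendsto_prod_geomChar hk hσ u).norm ?_
  filter_upwards [eventually_ge_atTop (2 * N)] with M hM
  obtain ⟨t, rfl⟩ := Nat.exists_eq_add_of_le hM
  have hx : ∀ m : ℕ, 0 < σ * ((m + 1 : ℕ) : ℝ) ^ k := fun m => by positivity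
  rw [Finset.prod_range_add, norm_mul]
  have h1 : ‖∏ i ∈ Finset.range t, geomChar (σ * ((2 * N + i + 1 : ℕ) : ℝ) ^ k)
      (σ * ((2 * N + i + 1 : ℕ) : ℝ) ^ k * u)‖ ≤ 1 := by
    rw [norm_prod]
    exact Finset.prod_le_one (fun _ _ => norm_nonneg _) fun i _ => norm_geomChar_le_one (hx _) _
  refine (mul_le_of_le_one_right (norm_nonneg _) h1).trans ?_
  refine le_of_sq_le_sq ?_ (by positivity)
  rw [norm_prod, ← Finset.prod_pow, ← pow_mul, mul_comm N 2]
  calc ∏ i ∈ Finset.range (2 * N), ‖geomChar (σ * ((i + 1 : ℕ) : ℝ) ^ k)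
        (σ * ((i + 1 : ℕ) : ℝ) ^ k * u)‖ ^ 2
      ≤ ∏ i ∈ Finset.range (2 * N), (1 + u ^ 2 / 8)⁻¹ := by
        refine Finset.prod_le_prod (fun _ _ => sq_nonneg _) fun i hi => ?_
        have hi' : i + 1 ≤ 2 * N := Finset.mem_range.1 hi
        have hi2 : ((i + 1 : ℕ) : ℝ) ≤ 2 * N := by exact_mod_cast hi'
        have hw : max 1 |u| * (σ * ((i + 1 : ℕ) : ℝ) ^ k) ≤ 1 := by
          refine le_trans ?_ hN
          rw [mul_assoc]
          gcongr
        have h0 := hx i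
        refine norm_geomChar_sq_le h0 ?_ ?_
        · exact le_trans (le_mul_of_one_le_left h0.le (le_max_left _ _)) hw
        · rw [abs_mul, abs_of_pos h0, mul_comm]
          exact le_trans (mul_le_mul_of_nonneg_right (le_max_right _ _) h0.le) hw
    _ = _ := by rw [Finset.prod_const, Finset.card_range]

theorem norm_pkRatio_le {k : ℕ} (hk : k ≠ 0) {σ : ℝ} (hσ : 0 < σ) (u : ℝ) :
    ‖pkRatio k σ u‖ ≤ 16 * (1 + |u|) ^ 3 / (1 + u ^ 2 * σ ^ (-(k : ℝ)⁻¹)) := by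
  have hk0 : (0 : ℝ) < k := by positivity
  set w := max 1 |u| with hw
  have hw1 : 1 ≤ w := le_max_left _ _
  have hw0 : 0 < w := by linarith
  set y := (w * σ) ^ (-(k : ℝ)⁻¹) with hy
  have hy0 : 0 < y := by positivity
  have hyk : y ^ k = (w * σ)⁻¹ := by
    rw [hy, ← Real.rpow_natCast, ← Real.rpow_mul (by positivity), neg_mul,
      inv_mul_cancel₀ hk0.ne', Real.rpow_neg_one]
  set N := ⌊y / 2⌋₊ with hN
  have hN1 : 2 * (N : ℝ) ≤ y := by
    have := Nat.floor_le (half_pos hy0).le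
    linarith
  have hN2 : y < 2 * (N + 1) := by
    have := Nat.lt_floor_add_one (y / 2)
    linarith
  have hmain := norm_pkRatio_le_of_mul_le hk hσ u (N := N) (by
    calc w * σ * (2 * (N : ℝ)) ^ k ≤ w * σ * y ^ k := by gcongr
      _ = 1 := by rw [hyk]; exact mul_inv_cancel₀ (by positivity))
  refine hmain.trans ?_
  set L := σ ^ (-(k : ℝ)⁻¹) with hL
  have hL0 : 0 < L := by positivity
  have hyL : L ≤ (1 + |u|) * y := by
    have h1 : y = w ^ (-(k : ℝ)⁻¹) * L := Real.mul_rpow hw0.le hσ.le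
    have h2 : w⁻¹ ≤ w ^ (-(k : ℝ)⁻¹) := by
      rw [← Real.rpow_neg_one]
      refine Real.rpow_le_rpow_of_exponent_le hw1 (neg_le_neg ?_)
      exact inv_le_one_of_one_le₀ (by exact_mod_cast Nat.one_le_iff_ne_zero.2 hk)
    have h3 : w ≤ 1 + |u| := max_le (by linarith [abs_nonneg u]) (by linarith)
    calc L = w * (w⁻¹ * L) := by rw [mul_inv_cancel_left₀ hw0.ne']
      _ ≤ (1 + |u|) * y := by rw [h1]; gcongr
  set a := 1 + |u| with ha
  have ha1 : 1 ≤ a := by linarith [abs_nonneg u]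
  have hua : u ^ 2 ≤ a ^ 2 := by
    rw [← sq_abs]
    gcongr
    linarith
  rw [inv_eq_one_div, div_le_div_iff₀ (by positivity) (by positivity), one_mul]
  have h4 : u ^ 2 * L ≤ u ^ 2 * (a * (2 * (N + 1))) := by gcongr; exact hyL.trans (by gcongr)
  have h5 : u ^ 2 * a ≤ a ^ 3 := by nlinarith
  have h6 : 1 ≤ a ^ 3 := one_le_pow₀ ha1
  have h7 : u ^ 2 * N * a ≤ u ^ 2 * N * a ^ 3 := by
    gcongr
    nlinarith
  nlinarith

theorem norm_pkRatio_mul_cexp_sub_one_le {k : ℕ} (hk : k ≠ 0) {σ : ℝ} (hσ : 0 < σ) {u : ℝ}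
    (hu : 8 * |u| ^ 3 * ∑' m, cumulantTerm k σ 3 m ≤ 1) :
    ‖pkRatio k σ u * cexp (-((u * ∑' m, cumulantTerm k σ 1 m : ℝ) * I -
        (u ^ 2 / 2 * ∑' m, cumulantTerm k σ 2 m : ℝ))) - 1‖ ≤
      16 * |u| ^ 3 * ∑' m, cumulantTerm k σ 3 m := by
  have hs : ∀ i ≤ 3, Tendsto (fun M => ∑ m ∈ Finset.range M, cumulantTerm k σ i m) atTop
      (nhds (∑' m, cumulantTerm k σ i m)) := fun i hi =>
    (summable_cumulantTerm hk hσ hi).hasSum.tendsto_sum_nat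
  have hlim : Tendsto (fun M : ℕ => (∏ m ∈ Finset.range M,
      geomChar (σ * ((m + 1 : ℕ) : ℝ) ^ k) (σ * ((m + 1 : ℕ) : ℝ) ^ k * u)) *
      cexp (-((u * ∑ m ∈ Finset.range M, cumulantTerm k σ 1 m : ℝ) * I -
        (u ^ 2 / 2 * ∑ m ∈ Finset.range M, cumulantTerm k σ 2 m : ℝ))) - 1) atTop
      (nhds (pkRatio k σ u * cexp (-((u * ∑' m, cumulantTerm k σ 1 m : ℝ) * I -
        (u ^ 2 / 2 * ∑' m, cumulantTerm k σ 2 m : ℝ))) - 1)) := by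
    refine ((tendsto_prod_geomChar hk hσ u).mul ?_).sub_const 1
    refine (Complex.continuous_exp.tendsto _).comp (Tendsto.neg (Tendsto.sub ?_ ?_))
    · exact ((Complex.continuous_ofReal.tendsto _).comp
        ((hs 1 (by norm_num)).const_mul u)).mul_const I
    · exact (Complex.continuous_ofReal.tendsto _).comp ((hs 2 (by norm_num)).const_mul _)
  refine le_of_tendsto hlim.norm (Eventually.of_forall fun M => ?_)
  have hx : ∀ m : ℕ, 0 < σ * ((m + 1 : ℕ) : ℝ) ^ k := fun m => by positivity
  choose e he1 he2 using fun m : ℕ => geomChar_eq_cexp (hx m) (σ * ((m + 1 : ℕ) : ℝ) ^ k * u)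
  have hfac : ∀ m : ℕ, geomChar (σ * ((m + 1 : ℕ) : ℝ) ^ k) (σ * ((m + 1 : ℕ) : ℝ) ^ k * u) =
      cexp ((u * cumulantTerm k σ 1 m : ℝ) * I - (u ^ 2 / 2 * cumulantTerm k σ 2 m : ℝ) + e m) := by
    intro m
    rw [he1, cumulantTerm, cumulantTerm]
    push_cast
    congr 1
    ring
  have hE : ‖∑ m ∈ Finset.range M, e m‖ ≤ 8 * |u| ^ 3 * ∑' m, cumulantTerm k σ 3 m := by
    refine (norm_sum_le _ _).trans ?_
    rw [← tsum_mul_left]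
    refine le_trans ?_ (((summable_cumulantTerm hk hσ le_rfl).mul_left _).sum_le_tsum
      (Finset.range M) fun m _ => mul_nonneg (by positivity) (cumulantTerm_nonneg k hσ 3 m))
    refine Finset.sum_le_sum fun m _ => (he2 m).trans (le_of_eq ?_)
    rw [abs_mul, abs_of_pos (hx m), cumulantTerm]
    ring
  have hprod : (∏ m ∈ Finset.range M,
      geomChar (σ * ((m + 1 : ℕ) : ℝ) ^ k) (σ * ((m + 1 : ℕ) : ℝ) ^ k * u)) *
      cexp (-((u * ∑ m ∈ Finset.range M, cumulantTerm k σ 1 m : ℝ) * I -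
        (u ^ 2 / 2 * ∑ m ∈ Finset.range M, cumulantTerm k σ 2 m : ℝ))) =
      cexp (∑ m ∈ Finset.range M, e m) := by
    simp only [hfac]
    rw [← Complex.exp_sum, ← Complex.exp_add]
    congr 1
    rw [Finset.sum_add_distrib, Finset.sum_sub_distrib]
    push_cast
    rw [← Finset.sum_mul, ← Finset.mul_sum, ← Finset.mul_sum]
    ring
  rw [hprod]
  refine (Complex.norm_exp_sub_one_le (hE.trans hu)).trans ?_
  linarith

theorem floor_bound_le_tsum_cumulantTerm_two {k : ℕ} (hk : k ≠ 0) {σ : ℝ} (hσ : 0 < σ) :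
    Real.exp (-1) * (σ ^ (-(k : ℝ)⁻¹) - 1) ≤ ∑' m, cumulantTerm k σ 2 m := by
  have hk0 : (0 : ℝ) < k := by positivity
  set L := σ ^ (-(k : ℝ)⁻¹) with hL
  have hL0 : 0 < L := by positivity
  have hLk : L ^ k = σ⁻¹ := by
    rw [hL, ← Real.rpow_natCast, ← Real.rpow_mul hσ.le, neg_mul,
      inv_mul_cancel₀ hk0.ne', Real.rpow_neg_one]
  refine le_trans ?_ (exp_neg_one_mul_le_tsum_cumulantTerm hk hσ (N := ⌊L⌋₊) ?_)
  · gcongr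
    linarith [Nat.lt_floor_add_one L]
  · calc σ * (⌊L⌋₊ : ℝ) ^ k ≤ σ * L ^ k := by
          gcongr
          exact Nat.floor_le hL0.le
      _ = 1 := by rw [hLk]; exact mul_inv_cancel₀ hσ.ne'

theorem tendsto_tsum_cumulantTerm_two {k : ℕ} (hk : k ≠ 0) :
    Tendsto (fun σ : ℝ => ∑' m, cumulantTerm k σ 2 m) (nhdsWithin 0 (Set.Ioi 0)) atTop := by
  have hk0 : (0 : ℝ) < k := by positivity
  have h1 : Tendsto (fun σ : ℝ => σ ^ (-(k : ℝ)⁻¹)) (nhdsWithin 0 (Set.Ioi 0)) atTop :=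
    tendsto_rpow_neg_nhdsGT_zero (by simpa using hk0)
  refine tendsto_atTop_mono' _ ?_
    ((tendsto_atTop_add_const_right _ (-1) h1).const_mul_atTop (Real.exp_pos (-1)))
  filter_upwards [self_mem_nhdsWithin] with σ hσ
  exact floor_bound_le_tsum_cumulantTerm_two hk hσ

theorem exists_norm_pkRatio_le {k : ℕ} (hk : k ≠ 0) : ∃ C, 0 < C ∧ ∀ σ : ℝ, 0 < σ → ∀ u : ℝ,
    ‖pkRatio k σ u‖ ≤ C * (1 + |u|) ^ 3 / (1 + u ^ 2 * ∑' m, cumulantTerm k σ 2 m) := by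
  obtain ⟨C, hC, h⟩ := exists_tsum_cumulantTerm_le hk
  refine ⟨16 * (1 + C), by positivity, fun σ hσ u => (norm_pkRatio_le hk hσ u).trans ?_⟩
  have h1 := h σ hσ 2 (by norm_num)
  have h0 : 0 ≤ ∑' m, cumulantTerm k σ 2 m := tsum_nonneg fun m => cumulantTerm_nonneg k hσ 2 m
  have hL0 : 0 < σ ^ (-(k : ℝ)⁻¹) := by positivity
  rw [div_le_div_iff₀ (by positivity) (by positivity)]
  have h2 : 1 + u ^ 2 * ∑' m, cumulantTerm k σ 2 m ≤ (1 + C) * (1 + u ^ 2 * σ ^ (-(k : ℝ)⁻¹)) := by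
    have := mul_le_mul_of_nonneg_left h1 (sq_nonneg u)
    have h3 : 0 ≤ u ^ 2 * σ ^ (-(k : ℝ)⁻¹) := by positivity
    linarith
  calc _ ≤ 16 * (1 + |u|) ^ 3 * ((1 + C) * (1 + u ^ 2 * σ ^ (-(k : ℝ)⁻¹))) := by gcongr
    _ = _ := by ring

theorem tendsto_cexp_mul_pkRatio {k : ℕ} (hk : k ≠ 0) {σ c : ℕ → ℝ} {B : ℝ}
    (hσ : Tendsto σ atTop (nhdsWithin 0 (Set.Ioi 0)))
    (hc : ∀ᶠ n in atTop, |∑' m, cumulantTerm k (σ n) 1 m - c n| ≤ B) (v : ℝ) :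
    Tendsto (fun n => cexp (-(((v / √(∑' m, cumulantTerm k (σ n) 2 m)) * c n : ℝ) * I)) *
      pkRatio k (σ n) (v / √(∑' m, cumulantTerm k (σ n) 2 m))) atTop
      (nhds (cexp (-(v : ℂ) ^ 2 / 2))) := by
  obtain ⟨C, hC, hCle⟩ := exists_tsum_cumulantTerm_le hk
  set A : ℕ → ℝ := fun n => ∑' m, cumulantTerm k (σ n) 2 m with hA
  have hAlim : Tendsto A atTop atTop := (tendsto_tsum_cumulantTerm_two hk).comp hσ
  have hσ0 : ∀ᶠ n in atTop, 0 < σ n := (tendsto_nhdsWithin_iff.1 hσ).2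
  set u : ℕ → ℝ := fun n => v / √(A n) with hu
  have hsq : Tendsto (fun n => √(A n)) atTop atTop := Real.tendsto_sqrt_atTop.comp hAlim
  have hu0 : Tendsto u atTop (nhds 0) := hsq.const_div_atTop v
  have hT3 : Tendsto (fun n => 8 * |u n| ^ 3 * ∑' m, cumulantTerm k (σ n) 3 m) atTop (nhds 0) := by
    have hz : Tendsto (fun n => 8 * |v| ^ 3 * (C * (Real.exp 1 + 1)) / √(A n)) atTop (nhds 0) :=
      hsq.const_div_atTop _
    refine squeeze_zero' ?_ ?_ hz
    · filter_upwards [hσ0] with n hn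
      exact mul_nonneg (by positivity) (tsum_nonneg fun m => cumulantTerm_nonneg k hn 3 m)
    · filter_upwards [hσ0, hAlim.eventually_ge_atTop 1] with n hn hA1
      have h1 := hCle (σ n) hn 3 le_rfl
      have h2 : Real.exp (-1) * (σ n ^ (-(k : ℝ)⁻¹) - 1) ≤ A n :=
        floor_bound_le_tsum_cumulantTerm_two hk hn
      have h3 : σ n ^ (-(k : ℝ)⁻¹) ≤ (Real.exp 1 + 1) * A n := by
        have := mul_le_mul_of_nonneg_left h2 (Real.exp_pos 1).le
        rw [← mul_assoc, ← Real.exp_add] at this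
        norm_num at this
        linarith
      have h4 : ∑' m, cumulantTerm k (σ n) 3 m ≤ C * ((Real.exp 1 + 1) * A n) :=
        h1.trans (by gcongr)
      have hs0 : 0 < √(A n) := Real.sqrt_pos.2 (by linarith)
      have hs2 : A n = √(A n) ^ 2 := (Real.sq_sqrt (by linarith)).symm
      calc 8 * |u n| ^ 3 * ∑' m, cumulantTerm k (σ n) 3 m
          ≤ 8 * |u n| ^ 3 * (C * ((Real.exp 1 + 1) * A n)) := by gcongr
        _ = 8 * (|v| / √(A n)) ^ 3 * (C * ((Real.exp 1 + 1) * √(A n) ^ 2)) := by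
            rw [← hs2, hu]
            simp only [abs_div, abs_of_pos hs0]
        _ = _ := by
            field_simp
  have hone : Tendsto (fun n => pkRatio k (σ n) (u n) *
      cexp (-((u n * ∑' m, cumulantTerm k (σ n) 1 m : ℝ) * I - (u n ^ 2 / 2 * A n : ℝ))))
      atTop (nhds 1) := by
    rw [tendsto_iff_norm_sub_tendsto_zero]
    refine squeeze_zero' (Eventually.of_forall fun _ => norm_nonneg _) ?_
      (by simpa using hT3.const_mul 2)
    filter_upwards [hσ0, hT3.eventually_le_const one_pos] with n hn h1
    refine (norm_pkRatio_mul_cexp_sub_one_le hk hn h1).trans (le_of_eq ?_)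
    ring
  have hphase : Tendsto (fun n => u n * (∑' m, cumulantTerm k (σ n) 1 m - c n)) atTop (nhds 0) := by
    refine hu0.zero_mul_isBoundedUnder_le ?_
    refine ⟨B, ?_⟩
    rw [eventually_map]
    filter_upwards [hc] with n hn
    exact hn
  have hphase' : Tendsto (fun n => cexp
      ((u n * (∑' m, cumulantTerm k (σ n) 1 m - c n) : ℝ) * I - (v : ℂ) ^ 2 / 2)) atTop
      (nhds (cexp (((0 : ℝ) : ℂ) * I - (v : ℂ) ^ 2 / 2))) :=
    (Complex.continuous_exp.tendsto _).comp
      ((((Complex.continuous_ofReal.tendsto 0).comp hphase).mul_const I).sub_const _)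
  have h := hone.mul hphase'
  rw [one_mul, Complex.ofReal_zero, zero_mul, zero_sub, ← neg_div] at h
  refine h.congr' ?_
  filter_upwards [hAlim.eventually_ge_atTop 1] with n hA1
  have h2 : u n ^ 2 / 2 * A n = v ^ 2 / 2 := by
    simp only [hu]
    rw [div_pow, Real.sq_sqrt (by linarith)]
    field_simp
  rw [h2, mul_assoc, ← Complex.exp_add, mul_comm]
  congr 2
  change _ = -(((u n * c n : ℝ) : ℂ) * I)
  push_cast
  ring

theorem norm_cexp_ofReal_mul_ofReal_mul_I (s x : ℝ) : ‖cexp (s * x * I)‖ = 1 := by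
  rw [← Complex.ofReal_mul, Complex.norm_exp_ofReal_mul_I]

theorem cexp_neg_sq_div_two_eq_integral (x : ℝ) :
    cexp (-(x : ℂ) ^ 2 / 2) =
      ∫ u, cexp (u * x * I) ∂(ProbabilityTheory.gaussianReal 0 1) := by
  have h := ProbabilityTheory.charFun_gaussianReal (μ := 0) (v := 1) x
  rw [MeasureTheory.charFun_apply_real] at h
  simp only [mul_comm (x : ℂ)] at h
  rw [h]
  congr 1
  push_cast
  ring

theorem integral_cexp_mul_exp_neg_sq (ν : MeasureTheory.Measure ℝ)
    [MeasureTheory.IsProbabilityMeasure ν] (t : ℝ) :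
    ∫ x, cexp (t * x * I) * cexp (-(x : ℂ) ^ 2 / 2) ∂ν =
      ∫ w, ProbabilityTheory.gaussianPDFReal 0 1 (w - t) • MeasureTheory.charFun ν w := by
  have h1 : ∀ x : ℝ, cexp (t * x * I) * cexp (-(x : ℂ) ^ 2 / 2) =
      ∫ u : ℝ, cexp (((u + t : ℝ) : ℂ) * x * I) ∂(ProbabilityTheory.gaussianReal 0 1) := fun x => by
    rw [cexp_neg_sq_div_two_eq_integral, ← MeasureTheory.integral_const_mul]
    refine MeasureTheory.integral_congr_ae (Eventually.of_forall fun u => ?_)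
    simp only [← Complex.exp_add]
    push_cast
    ring_nf
  simp only [h1]
  rw [MeasureTheory.integral_integral_swap]
  · rw [ProbabilityTheory.integral_gaussianReal_eq_integral_smul one_ne_zero,
      ← MeasureTheory.integral_sub_right_eq_self _ t]
    simp only [sub_add_cancel, ← MeasureTheory.charFun_apply_real]
  · refine MeasureTheory.Integrable.of_bound (C := 1) (Continuous.aestronglyMeasurable ?_)
      (Eventually.of_forall fun p => ?_)
    · simp only [Function.uncurry_def]
      fun_prop
    · simp only [Function.uncurry_def]
      exact (norm_cexp_ofReal_mul_ofReal_mul_I _ _).le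

theorem one_add_abs_pow_three_mul_gaussianPDFReal_le (t w : ℝ) :
    (1 + |w|) ^ 3 * ProbabilityTheory.gaussianPDFReal 0 1 (w - t) ≤ 27 * Real.exp (|t| + 3) := by
  have h1 : (√(2 * Real.pi))⁻¹ ≤ 1 := by
    refine inv_le_one_of_one_le₀ (Real.one_le_sqrt.2 ?_)
    linarith [Real.pi_gt_three]
  have h2 : (1 + |w|) ^ 3 ≤ 27 * Real.exp (1 + |w|) := by
    have h3 : 1 + |w| ≤ 3 * Real.exp ((1 + |w|) / 3) := by
      linarith [Real.add_one_le_exp ((1 + |w|) / 3)]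
    calc (1 + |w|) ^ 3 ≤ (3 * Real.exp ((1 + |w|) / 3)) ^ 3 := by gcongr
      _ = _ := by
        rw [mul_pow, ← Real.exp_nat_mul]
        norm_num
        ring_nf
  have h4 : |w| ≤ |w - t| + |t| := by
    have := abs_add_le (w - t) t
    rwa [sub_add_cancel] at this
  have h5 : 1 + |w| + -(w - t) ^ 2 / 2 ≤ |t| + 3 := by
    rw [← sq_abs (w - t)]
    nlinarith [sq_nonneg (|w - t| - 1)]
  simp only [ProbabilityTheory.gaussianPDFReal, NNReal.coe_one, mul_one, sub_zero]
  calc (1 + |w|) ^ 3 * ((√(2 * Real.pi))⁻¹ * Real.exp (-(w - t) ^ 2 / 2))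
      ≤ 27 * Real.exp (1 + |w|) * (1 * Real.exp (-(w - t) ^ 2 / 2)) := by gcongr
    _ = 27 * Real.exp (1 + |w| + -(w - t) ^ 2 / 2) := by
        rw [Real.exp_add (1 + |w|)]
        ring
    _ ≤ _ := by gcongr

theorem integral_cexp_neg_sq_div_two : ∫ v : ℝ, cexp (-(v : ℂ) ^ 2 / 2) = √(2 * Real.pi) := by
  have h : ∀ v : ℝ, cexp (-(v : ℂ) ^ 2 / 2) = ((Real.exp (-(1 / 2) * v ^ 2) : ℝ) : ℂ) := fun v => by
    push_cast
    congr 1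
    ring
  simp only [h]
  rw [integral_complex_ofReal, integral_gaussian]
  congr 2
  ring

theorem continuous_gaussianPDFReal : Continuous (ProbabilityTheory.gaussianPDFReal 0 1) := by
  rw [ProbabilityTheory.gaussianPDFReal_def]
  fun_prop

theorem tendsto_sqrt_mul_integral_cexp_mul_exp_neg_sq {ν : ℕ → MeasureTheory.Measure ℝ}
    [∀ n, MeasureTheory.IsProbabilityMeasure (ν n)] {A : ℕ → ℝ} {C : ℝ}
    (hA : Tendsto A atTop atTop)
    (hbound : ∀ᶠ n in atTop, ∀ u : ℝ,
      ‖MeasureTheory.charFun (ν n) u‖ ≤ C * (1 + |u|) ^ 3 / (1 + u ^ 2 * A n))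
    (hlim : ∀ v : ℝ, Tendsto (fun n => MeasureTheory.charFun (ν n) (v / √(A n))) atTop
      (nhds (cexp (-(v : ℂ) ^ 2 / 2)))) (t : ℝ) :
    Tendsto (fun n => (√(A n) : ℂ) * ∫ x, cexp (t * x * I) * cexp (-(x : ℂ) ^ 2 / 2) ∂(ν n)) atTop
      (nhds (cexp (-(t : ℂ) ^ 2 / 2))) := by
  have hsq : Tendsto (fun n => √(A n)) atTop atTop := Real.tendsto_sqrt_atTop.comp hA
  have hdom : Tendsto (fun n => ∫ v : ℝ, ProbabilityTheory.gaussianPDFReal 0 1 (v / √(A n) - t) •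
      MeasureTheory.charFun (ν n) (v / √(A n))) atTop
      (nhds (∫ v : ℝ, ProbabilityTheory.gaussianPDFReal 0 1 (0 - t) •
        cexp (-(v : ℂ) ^ 2 / 2))) := by
    refine MeasureTheory.tendsto_integral_filter_of_dominated_convergence
      (fun v => C * (27 * Real.exp (|t| + 3)) * (1 + v ^ 2)⁻¹) ?_ ?_
      (integrable_inv_one_add_sq.const_mul _) ?_
    · refine Eventually.of_forall fun n => Continuous.aestronglyMeasurable ?_
      exact (continuous_gaussianPDFReal.comp (by fun_prop)).smul
        (MeasureTheory.continuous_charFun.comp (by fun_prop))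
    · filter_upwards [hbound, hA.eventually_gt_atTop 0] with n hn hA0
      refine Eventually.of_forall fun v => ?_
      have hp := ProbabilityTheory.gaussianPDFReal_nonneg 0 1 (v / √(A n) - t)
      have hC : 0 ≤ C := by
        have := (norm_nonneg _).trans (hn 0)
        simpa using this
      have hq : (v / √(A n)) ^ 2 * A n = v ^ 2 := by
        rw [div_pow, Real.sq_sqrt hA0.le, div_mul_cancel₀ _ hA0.ne']
      have hn' := hn (v / √(A n))
      rw [hq] at hn'
      rw [norm_smul, Real.norm_of_nonneg hp]
      calc _ ≤ ProbabilityTheory.gaussianPDFReal 0 1 (v / √(A n) - t) *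
            (C * (1 + |v / √(A n)|) ^ 3 / (1 + v ^ 2)) := by gcongr
        _ = C * ((1 + |v / √(A n)|) ^ 3 *
            ProbabilityTheory.gaussianPDFReal 0 1 (v / √(A n) - t)) * (1 + v ^ 2)⁻¹ := by ring
        _ ≤ _ := by
            have h := one_add_abs_pow_three_mul_gaussianPDFReal_le t (v / √(A n))
            exact mul_le_mul_of_nonneg_right (mul_le_mul_of_nonneg_left h hC) (by positivity)
    · refine Eventually.of_forall fun v => Tendsto.smul ?_ (hlim v)
      exact (continuous_gaussianPDFReal.tendsto _).comp ((hsq.const_div_atTop v).sub_const t)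
  have hval : ∫ v : ℝ, ProbabilityTheory.gaussianPDFReal 0 1 (0 - t) • cexp (-(v : ℂ) ^ 2 / 2) =
      cexp (-(t : ℂ) ^ 2 / 2) := by
    rw [MeasureTheory.integral_smul, integral_cexp_neg_sq_div_two]
    simp only [ProbabilityTheory.gaussianPDFReal, NNReal.coe_one, mul_one, sub_zero, zero_sub,
      Complex.real_smul]
    have h2 : ((√(2 * Real.pi) : ℝ) : ℂ) ≠ 0 := by
      rw [Complex.ofReal_ne_zero]
      positivity
    push_cast
    field_simp
  rw [hval] at hdom
  refine hdom.congr' ?_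
  filter_upwards [hA.eventually_gt_atTop 0] with n hA0
  rw [integral_cexp_mul_exp_neg_sq]
  have h3 := MeasureTheory.Measure.integral_comp_div (fun w : ℝ =>
    ProbabilityTheory.gaussianPDFReal 0 1 (w - t) • MeasureTheory.charFun (ν n) w) (√(A n))
  rw [h3, abs_of_nonneg (Real.sqrt_nonneg _), Complex.real_smul]

theorem tendsto_charFun_tilted {ν : ℕ → MeasureTheory.Measure ℝ}
    [∀ n, MeasureTheory.IsProbabilityMeasure (ν n)] {A : ℕ → ℝ} {C : ℝ}
    (hA : Tendsto A atTop atTop)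
    (hbound : ∀ᶠ n in atTop, ∀ u : ℝ,
      ‖MeasureTheory.charFun (ν n) u‖ ≤ C * (1 + |u|) ^ 3 / (1 + u ^ 2 * A n))
    (hlim : ∀ v : ℝ, Tendsto (fun n => MeasureTheory.charFun (ν n) (v / √(A n))) atTop
      (nhds (cexp (-(v : ℂ) ^ 2 / 2)))) (t : ℝ) :
    Tendsto (fun n => MeasureTheory.charFun ((ν n).tilted fun x => -x ^ 2 / 2) t) atTop
      (nhds (cexp (-(t : ℂ) ^ 2 / 2))) := by
  have h1 := tendsto_sqrt_mul_integral_cexp_mul_exp_neg_sq hA hbound hlim t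
  have h0 := tendsto_sqrt_mul_integral_cexp_mul_exp_neg_sq hA hbound hlim 0
  have h := h1.div h0 (Complex.exp_ne_zero _)
  simp only [Complex.ofReal_zero, ne_eq, OfNat.ofNat_ne_zero, not_false_eq_true, zero_pow, neg_zero,
    zero_div, Complex.exp_zero, div_one, zero_mul, one_mul] at h
  refine h.congr' ?_
  filter_upwards [hA.eventually_gt_atTop 0] with n hA0
  have hs : ((√(A n) : ℝ) : ℂ) ≠ 0 := by
    rw [Complex.ofReal_ne_zero]
    positivity
  have hZ : ∫ x : ℝ, cexp (-(x : ℂ) ^ 2 / 2) ∂(ν n) =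
      ((∫ x : ℝ, Real.exp (-x ^ 2 / 2) ∂(ν n) : ℝ) : ℂ) := by
    rw [← integral_complex_ofReal]
    push_cast
    rfl
  rw [Pi.div_apply, mul_div_mul_left _ _ hs, MeasureTheory.charFun_apply_real,
    MeasureTheory.integral_tilted, hZ, ← MeasureTheory.integral_div]
  refine MeasureTheory.integral_congr_ae (Eventually.of_forall fun x => ?_)
  simp only [Complex.real_smul]
  push_cast
  ring

theorem integrable_exp_neg_sq_div_two (ν : MeasureTheory.Measure ℝ)
    [MeasureTheory.IsProbabilityMeasure ν] :
    MeasureTheory.Integrable (fun x => Real.exp (-x ^ 2 / 2)) ν := by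
  refine MeasureTheory.Integrable.of_bound (C := 1)
    (Continuous.aestronglyMeasurable (by fun_prop)) (Eventually.of_forall fun x => ?_)
  rw [Real.norm_of_nonneg (Real.exp_pos _).le, Real.exp_le_one_iff]
  linarith [sq_nonneg x]

/-- A sequence of probability measures whose characteristic functions decay fast enough is
asymptotically uniform on bounded intervals. -/
theorem tendsto_tilted_Ioc {ν : ℕ → MeasureTheory.Measure ℝ}
    [∀ n, MeasureTheory.IsProbabilityMeasure (ν n)] {A : ℕ → ℝ} {C : ℝ}
    (hA : Tendsto A atTop atTop)
    (hbound : ∀ᶠ n in atTop, ∀ u : ℝ,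
      ‖MeasureTheory.charFun (ν n) u‖ ≤ C * (1 + |u|) ^ 3 / (1 + u ^ 2 * A n))
    (hlim : ∀ v : ℝ, Tendsto (fun n => MeasureTheory.charFun (ν n) (v / √(A n))) atTop
      (nhds (cexp (-(v : ℂ) ^ 2 / 2)))) (a b : ℝ) :
    Tendsto (fun n => ((ν n).tilted fun x => -x ^ 2 / 2).real (Set.Ioc a b)) atTop
      (nhds ((ProbabilityTheory.gaussianReal 0 1).real (Set.Ioc a b))) := by
  have hp : ∀ n, MeasureTheory.IsProbabilityMeasure ((ν n).tilted fun x => -x ^ 2 / 2) :=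
    fun n => MeasureTheory.isProbabilityMeasure_tilted (integrable_exp_neg_sq_div_two (ν n))
  let μ : ℕ → MeasureTheory.ProbabilityMeasure ℝ := fun n =>
    ⟨(ν n).tilted fun x => -x ^ 2 / 2, hp n⟩
  let γ : MeasureTheory.ProbabilityMeasure ℝ := ⟨ProbabilityTheory.gaussianReal 0 1, inferInstance⟩
  have hμ : Tendsto μ atTop (nhds γ) := by
    refine MeasureTheory.ProbabilityMeasure.tendsto_iff_tendsto_charFun.2 fun t => ?_
    have h1 := tendsto_charFun_tilted hA hbound hlim t
    have h2 : MeasureTheory.charFun (γ : MeasureTheory.Measure ℝ) t = cexp (-(t : ℂ) ^ 2 / 2) := by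
      refine (ProbabilityTheory.charFun_gaussianReal t).trans ?_
      congr 1
      push_cast
      ring
    rw [h2]
    exact h1
  have hnull : (γ : MeasureTheory.Measure ℝ) (frontier (Set.Ioc a b)) = 0 := by
    have : MeasureTheory.NullSingletonClass (γ : MeasureTheory.Measure ℝ) :=
      ProbabilityTheory.nullSingletonClass_gaussianReal one_ne_zero
    refine Set.Finite.measure_zero ?_ _
    rcases lt_or_ge a b with h | h
    · rw [frontier_Ioc h]
      exact Set.toFinite _
    · simp [Set.Ioc_eq_empty_of_le h]
  have h := MeasureTheory.ProbabilityMeasure.tendsto_measure_of_null_frontier_of_tendsto' hμ hnull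
  exact (ENNReal.tendsto_toReal (MeasureTheory.measure_ne_top _ _)).comp h

theorem hasSum_pkGen {k : ℕ} (hk : k ≠ 0) {z : ℂ} (hz : ‖z‖ < 1) :
    HasSum (fun j : ℕ => (pk k j : ℂ) * z ^ j) (pkGen k 0 z) := by
  simp only [pk_eq_pkTail hk]
  exact (summable_pkTail_complex hk 0 hz).hasSum

/-- The probability that a partition into `k`-th powers, chosen according to the Boltzmann
distribution with parameter `σ`, is a partition of `j`. -/
noncomputable def pkWeight (k : ℕ) (σ : ℝ) (j : ℕ) : ℝ :=
  pk k j * Real.exp (-σ) ^ j / ∑' i : ℕ, pk k i * Real.exp (-σ) ^ i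

theorem summable_pk_mul_exp {k : ℕ} (hk : k ≠ 0) {σ : ℝ} (hσ : 0 < σ) :
    Summable fun i : ℕ => (pk k i : ℝ) * Real.exp (-σ) ^ i := by
  simp only [pk_eq_pkTail hk]
  exact summable_pkTail hk 0 (Real.exp_pos _).le (by simpa using hσ)

theorem tsum_pk_mul_exp_pos {k : ℕ} (hk : k ≠ 0) {σ : ℝ} (hσ : 0 < σ) :
    0 < ∑' i : ℕ, (pk k i : ℝ) * Real.exp (-σ) ^ i :=
  (summable_pk_mul_exp hk hσ).tsum_pos (fun _ => by positivity) 0 (by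
    have := pk_pos hk 0
    positivity)

theorem pkWeight_nonneg (k : ℕ) (σ : ℝ) (j : ℕ) : 0 ≤ pkWeight k σ j :=
  div_nonneg (by positivity) (tsum_nonneg fun _ => by positivity)

theorem hasSum_pkWeight {k : ℕ} (hk : k ≠ 0) {σ : ℝ} (hσ : 0 < σ) : HasSum (pkWeight k σ) 1 := by
  have h := (summable_pk_mul_exp hk hσ).hasSum.div_const
    (∑' i : ℕ, (pk k i : ℝ) * Real.exp (-σ) ^ i)
  rwa [div_self (tsum_pk_mul_exp_pos hk hσ).ne'] at h

/-- The distribution of `σ` times the size of a random partition into `k`-th powers chosen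
according to the Boltzmann distribution with parameter `σ`, translated by `-c`. -/
noncomputable def pkMeasure (k : ℕ) (σ c : ℝ) : MeasureTheory.Measure ℝ :=
  MeasureTheory.Measure.sum fun j : ℕ =>
    ENNReal.ofReal (pkWeight k σ j) • MeasureTheory.Measure.dirac (j * σ - c)

theorem isProbabilityMeasure_pkMeasure {k : ℕ} (hk : k ≠ 0) {σ : ℝ} (hσ : 0 < σ) (c : ℝ) :
    MeasureTheory.IsProbabilityMeasure (pkMeasure k σ c) := by
  constructor
  rw [pkMeasure, MeasureTheory.Measure.sum_apply _ MeasurableSet.univ]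
  simp only [MeasureTheory.Measure.smul_apply, MeasureTheory.measure_univ, smul_eq_mul, mul_one]
  rw [← ENNReal.ofReal_tsum_of_nonneg (pkWeight_nonneg k σ) (hasSum_pkWeight hk hσ).summable,
    (hasSum_pkWeight hk hσ).tsum_eq, ENNReal.ofReal_one]

theorem hasSum_integral_pkMeasure {E : Type*} [NormedAddCommGroup E] [NormedSpace ℝ E]
    [CompleteSpace E] {k : ℕ} {σ c : ℝ} {f : ℝ → E}
    (hf : MeasureTheory.Integrable f (pkMeasure k σ c)) :
    HasSum (fun j : ℕ => pkWeight k σ j • f (j * σ - c)) (∫ x, f x ∂(pkMeasure k σ c)) := by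
  unfold pkMeasure at hf ⊢
  have h := MeasureTheory.hasSum_integral_measure hf
  simpa only [MeasureTheory.integral_smul_measure, MeasureTheory.integral_dirac,
    ENNReal.toReal_ofReal (pkWeight_nonneg k σ _)] using h

theorem charFun_pkMeasure {k : ℕ} (hk : k ≠ 0) {σ : ℝ} (hσ : 0 < σ) (c u : ℝ) :
    MeasureTheory.charFun (pkMeasure k σ c) u = cexp (-((u * c : ℝ) * I)) * pkRatio k σ u := by
  have := isProbabilityMeasure_pkMeasure hk hσ c
  have hf : MeasureTheory.Integrable (fun x : ℝ => cexp (u * x * I)) (pkMeasure k σ c) := by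
    refine MeasureTheory.Integrable.of_bound (C := 1)
      (Continuous.aestronglyMeasurable (by fun_prop)) (Eventually.of_forall fun x => ?_)
    exact (norm_cexp_ofReal_mul_ofReal_mul_I _ _).le
  have h1 : ‖cexp (-σ + σ * u * I)‖ < 1 := by
    rw [Complex.norm_exp]
    simpa using hσ
  have h2 : ‖cexp (-σ)‖ < 1 := by
    rw [Complex.norm_exp]
    simpa using hσ
  have hF : ((∑' i : ℕ, (pk k i : ℝ) * Real.exp (-σ) ^ i : ℝ) : ℂ) = pkGen k 0 (cexp (-σ)) := by
    rw [← (hasSum_pkGen hk h2).tsum_eq, Complex.ofReal_tsum]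
    push_cast
    rfl
  rw [MeasureTheory.charFun_apply_real]
  refine (hasSum_integral_pkMeasure hf).unique ?_
  have h := ((hasSum_pkGen hk h1).div_const (pkGen k 0 (cexp (-σ)))).mul_left
    (cexp (-((u * c : ℝ) * I)))
  refine h.congr_fun fun j => ?_
  rw [pkWeight, Complex.real_smul, ← hF]
  have h3 : cexp (-σ + σ * u * I) ^ j * cexp (-((u * c : ℝ) * I)) =
      cexp (-σ) ^ j * cexp (u * ((j * σ - c : ℝ) : ℂ) * I) := by
    rw [← Complex.exp_nat_mul, ← Complex.exp_nat_mul, ← Complex.exp_add, ← Complex.exp_add]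
    congr 1
    push_cast
    ring
  push_cast at h3 ⊢
  linear_combination (-(pk k j : ℂ) / ∑' i : ℕ, (pk k i : ℂ) * cexp (-σ) ^ i) * h3

theorem mem_Ioc_floor_iff {σ : ℝ} (hσ : 0 < σ) {n j : ℕ} {a b : ℝ} (ha : 0 ≤ n + a / σ) :
    j ∈ Finset.Ioc ⌊n + a / σ⌋₊ ⌊n + b / σ⌋₊ ↔ (j * σ - n * σ : ℝ) ∈ Set.Ioc a b := by
  rw [Finset.mem_Ioc, Set.mem_Ioc, Nat.floor_lt ha]
  have h1 : (n + a / σ < j) ↔ a < j * σ - n * σ := by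
    rw [← lt_sub_iff_add_lt', div_lt_iff₀ hσ, sub_mul]
  have h2 : (j : ℝ) ≤ n + b / σ ↔ (j * σ - n * σ : ℝ) ≤ b := by
    rw [← sub_le_iff_le_add', le_div_iff₀ hσ, sub_mul]
  rw [← h1, ← h2]
  refine and_congr_right fun h => Nat.le_floor_iff' ?_
  rintro rfl
  exact absurd (ha.trans_lt h) (by simp)

theorem exists_tilted_pkMeasure_Ioc_eq {k : ℕ} (hk : k ≠ 0) {σ : ℝ} (hσ : 0 < σ) (n : ℕ) :
    ∃ K : ℝ, 0 < K ∧ ∀ a b : ℝ, 0 ≤ n + a / σ →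
      ((pkMeasure k σ (n * σ)).tilted fun x => -x ^ 2 / 2).real (Set.Ioc a b) =
        K * ∑ j ∈ Finset.Ioc ⌊n + a / σ⌋₊ ⌊n + b / σ⌋₊,
          (pk k j : ℝ) * Real.exp (-((j - n) * σ) - ((j - n) * σ) ^ 2 / 2) := by
  have hp := isProbabilityMeasure_pkMeasure hk hσ (n * σ)
  set ν := pkMeasure k σ (n * σ) with hν
  have hf_int := integrable_exp_neg_sq_div_two ν
  set Z := ∫ x, Real.exp (-x ^ 2 / 2) ∂ν with hZ
  have hZ0 : 0 < Z := MeasureTheory.integral_exp_pos hf_int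
  set F := ∑' i : ℕ, (pk k i : ℝ) * Real.exp (-σ) ^ i with hF
  have hF0 : 0 < F := tsum_pk_mul_exp_pos hk hσ
  refine ⟨Real.exp (-(n * σ)) / (F * Z), by positivity, fun a b ha => ?_⟩
  have hmeas : MeasurableSet (Set.Ioc a b) := measurableSet_Ioc
  rw [← MeasureTheory.integral_indicator_one hmeas, MeasureTheory.integral_tilted]
  have hf_int2 : MeasureTheory.Integrable (fun x => (Real.exp (-x ^ 2 / 2) / Z) •
      (Set.Ioc a b).indicator (1 : ℝ → ℝ) x) ν := by
    have := (hf_int.div_const Z).indicator hmeas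
    refine this.congr (Eventually.of_forall fun x => ?_)
    by_cases hx : x ∈ Set.Ioc a b <;> simp [hx]
  rw [← (hasSum_integral_pkMeasure hf_int2).tsum_eq, Finset.mul_sum]
  rw [tsum_eq_sum (s := Finset.Ioc ⌊n + a / σ⌋₊ ⌊n + b / σ⌋₊)]
  · refine Finset.sum_congr rfl fun j hj => ?_
    have hmem : (j * σ - n * σ : ℝ) ∈ Set.Ioc a b :=
      (mem_Ioc_floor_iff hσ ha).1 hj
    rw [Set.indicator_of_mem hmem, pkWeight, ← Real.exp_nat_mul]
    simp only [smul_eq_mul, Pi.one_apply, mul_one]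
    have h1 : Real.exp (j * -σ) * Real.exp (-(j * σ - n * σ) ^ 2 / 2) =
        Real.exp (-(n * σ)) * Real.exp (-((j - n) * σ) - ((j - n) * σ) ^ 2 / 2) := by
      rw [← Real.exp_add, ← Real.exp_add]
      congr 1
      ring
    rw [← hF, div_mul_div_comm, div_mul_eq_mul_div]
    congr 1
    linear_combination (pk k j : ℝ) * h1
  · intro j hj
    have hmem : (j * σ - n * σ : ℝ) ∉ Set.Ioc a b := fun h =>
      hj ((mem_Ioc_floor_iff hσ ha).2 h)
    rw [Set.indicator_of_notMem hmem, smul_zero, smul_zero]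

theorem neg_sub_sq_div_two_antitone {x y : ℝ} (hx : -1 ≤ x) (hxy : x ≤ y) :
    -y - y ^ 2 / 2 ≤ -x - x ^ 2 / 2 := by
  nlinarith

theorem card_Ioc_floor_le {s t : ℝ} (hs : 0 ≤ s) (hst : s ≤ t) :
    ((Finset.Ioc ⌊s⌋₊ ⌊t⌋₊).card : ℝ) ≤ t - s + 1 := by
  rw [Nat.card_Ioc, Nat.cast_sub (Nat.floor_le_floor hst)]
  linarith [Nat.floor_le (hs.trans hst), Nat.lt_floor_add_one s]

theorem le_card_Ioc_floor {s t : ℝ} (hs : 0 ≤ s) (hst : s ≤ t) :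
    t - s - 1 ≤ ((Finset.Ioc ⌊s⌋₊ ⌊t⌋₊).card : ℝ) := by
  rw [Nat.card_Ioc, Nat.cast_sub (Nat.floor_le_floor hst)]
  linarith [Nat.floor_le hs, Nat.lt_floor_add_one t]

theorem sub_mem_of_mem_Ioc_floor {σ : ℝ} (hσ : 0 < σ) {n j : ℕ} {a b : ℝ} (ha : 0 ≤ n + a / σ)
    (hj : j ∈ Finset.Ioc ⌊n + a / σ⌋₊ ⌊n + b / σ⌋₊) : (j - n) * σ ∈ Set.Ioc a b := by
  have := (mem_Ioc_floor_iff hσ ha).1 hj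
  rwa [← sub_mul] at this

theorem sum_Ioc_pk_le {k : ℕ} (hk : k ≠ 0) {σ : ℝ} (hσ : 0 < σ) {n : ℕ} {a b : ℝ}
    (ha : -1 ≤ a) (hab : a ≤ b) (hn : 0 ≤ n + a / σ) :
    ∑ j ∈ Finset.Ioc ⌊n + a / σ⌋₊ ⌊n + b / σ⌋₊,
      (pk k j : ℝ) * Real.exp (-((j - n) * σ) - ((j - n) * σ) ^ 2 / 2) ≤
      pk k ⌊n + b / σ⌋₊ * Real.exp (-a - a ^ 2 / 2) * ((b - a) / σ + 1) := by
  calc _ ≤ ∑ j ∈ Finset.Ioc ⌊n + a / σ⌋₊ ⌊n + b / σ⌋₊,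
        (pk k ⌊n + b / σ⌋₊ : ℝ) * Real.exp (-a - a ^ 2 / 2) := by
        refine Finset.sum_le_sum fun j hj => ?_
        have hj1 := sub_mem_of_mem_Ioc_floor hσ hn hj
        have hj2 : pk k j ≤ pk k ⌊n + b / σ⌋₊ := pk_monotone hk (Finset.mem_Ioc.1 hj).2
        have hj3 := neg_sub_sq_div_two_antitone ha hj1.1.le
        gcongr
    _ = pk k ⌊n + b / σ⌋₊ * Real.exp (-a - a ^ 2 / 2) *
          ((Finset.Ioc ⌊n + a / σ⌋₊ ⌊n + b / σ⌋₊).card : ℝ) := by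
        rw [Finset.sum_const, nsmul_eq_mul, mul_comm]
    _ ≤ _ := by
        gcongr
        refine (card_Ioc_floor_le hn (by gcongr)).trans (le_of_eq ?_)
        ring

theorem le_sum_Ioc_pk {k : ℕ} (hk : k ≠ 0) {σ : ℝ} (hσ : 0 < σ) {n : ℕ} {a b : ℝ}
    (ha : -1 ≤ a) (hab : a ≤ b) (hn : 0 ≤ n + a / σ) :
    pk k ⌊n + a / σ⌋₊ * Real.exp (-b - b ^ 2 / 2) * ((b - a) / σ - 1) ≤
    ∑ j ∈ Finset.Ioc ⌊n + a / σ⌋₊ ⌊n + b / σ⌋₊,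
      (pk k j : ℝ) * Real.exp (-((j - n) * σ) - ((j - n) * σ) ^ 2 / 2) := by
  calc _ ≤ pk k ⌊n + a / σ⌋₊ * Real.exp (-b - b ^ 2 / 2) *
          ((Finset.Ioc ⌊n + a / σ⌋₊ ⌊n + b / σ⌋₊).card : ℝ) := by
        gcongr
        refine le_trans (le_of_eq ?_) (le_card_Ioc_floor hn (by gcongr))
        ring
    _ = ∑ j ∈ Finset.Ioc ⌊n + a / σ⌋₊ ⌊n + b / σ⌋₊,
        (pk k ⌊n + a / σ⌋₊ : ℝ) * Real.exp (-b - b ^ 2 / 2) := by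
        rw [Finset.sum_const, nsmul_eq_mul, mul_comm]
    _ ≤ _ := by
        refine Finset.sum_le_sum fun j hj => ?_
        have hj1 := sub_mem_of_mem_Ioc_floor hσ hn hj
        have hj2 : pk k ⌊n + a / σ⌋₊ ≤ pk k j := pk_monotone hk (Finset.mem_Ioc.1 hj).1.le
        have hj3 := neg_sub_sq_div_two_antitone (ha.trans hj1.1.le) hj1.2
        gcongr

theorem gaussianReal_real_Ioc_eq (a b : ℝ) :
    (ProbabilityTheory.gaussianReal 0 1).real (Set.Ioc a b) =
      ∫ x in Set.Ioc a b, ProbabilityTheory.gaussianPDFReal 0 1 x := by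
  rw [MeasureTheory.measureReal_def, ProbabilityTheory.gaussianReal_apply_eq_integral 0 one_ne_zero,
    ENNReal.toReal_ofReal]
  exact MeasureTheory.integral_nonneg fun x => ProbabilityTheory.gaussianPDFReal_nonneg 0 1 x

theorem gaussianPDFReal_eq (x : ℝ) : ProbabilityTheory.gaussianPDFReal 0 1 x =
    Real.exp (-x - x ^ 2 / 2) * Real.exp x / √(2 * Real.pi) := by
  simp only [ProbabilityTheory.gaussianPDFReal, NNReal.coe_one, mul_one, sub_zero]
  rw [← Real.exp_add, div_eq_mul_inv, mul_comm]
  ring_nf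

theorem le_gaussianReal_real_Ioc {a b : ℝ} (ha : -1 ≤ a) (hab : a ≤ b) :
    (b - a) * (Real.exp (-b - b ^ 2 / 2) * Real.exp a / √(2 * Real.pi)) ≤
      (ProbabilityTheory.gaussianReal 0 1).real (Set.Ioc a b) := by
  rw [gaussianReal_real_Ioc_eq]
  have h := MeasureTheory.setIntegral_mono_on
    (MeasureTheory.integrableOn_const (μ := MeasureTheory.volume) (s := Set.Ioc a b)
      (C := Real.exp (-b - b ^ 2 / 2) * Real.exp a / √(2 * Real.pi)) (by simp) (by simp))
    (ProbabilityTheory.integrable_gaussianPDFReal 0 1).integrableOn measurableSet_Ioc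
    (fun x hx => by
      rw [gaussianPDFReal_eq]
      have := neg_sub_sq_div_two_antitone (ha.trans hx.1.le) hx.2
      have := hx.1.le
      gcongr)
  simpa [MeasureTheory.setIntegral_const, hab] using h

theorem gaussianReal_real_Ioc_le {a b : ℝ} (ha : -1 ≤ a) (hab : a ≤ b) :
    (ProbabilityTheory.gaussianReal 0 1).real (Set.Ioc a b) ≤
      (b - a) * (Real.exp (-a - a ^ 2 / 2) * Real.exp b / √(2 * Real.pi)) := by
  rw [gaussianReal_real_Ioc_eq]
  have h := MeasureTheory.setIntegral_mono_on
    (ProbabilityTheory.integrable_gaussianPDFReal 0 1).integrableOn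
    (MeasureTheory.integrableOn_const (μ := MeasureTheory.volume) (s := Set.Ioc a b)
      (C := Real.exp (-a - a ^ 2 / 2) * Real.exp b / √(2 * Real.pi)) (by simp) (by simp))
    measurableSet_Ioc
    (fun x hx => by
      rw [gaussianPDFReal_eq]
      have := neg_sub_sq_div_two_antitone ha hx.1.le
      have := hx.2
      gcongr)
  simpa [MeasureTheory.setIntegral_const, hab] using h

theorem exists_tendsto_mul_pk_floor {k : ℕ} (hk : k ≠ 0) {σ : ℕ → ℝ} (hσ0 : ∀ n, 0 < σ n)
    (hσ : Tendsto σ atTop (nhds 0)) (hnσ : Tendsto (fun n => n * σ n) atTop atTop)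
    (hIoc : ∀ a b : ℝ, Tendsto (fun n =>
      ((pkMeasure k (σ n) (n * σ n)).tilted fun x => -x ^ 2 / 2).real (Set.Ioc a b)) atTop
      (nhds ((ProbabilityTheory.gaussianReal 0 1).real (Set.Ioc a b)))) :
    ∃ W : ℕ → ℝ, (∀ n, 0 < W n) ∧ ∀ y : ℝ, -1 < y →
      Tendsto (fun n => W n * pk k ⌊n + y / σ n⌋₊) atTop
        (nhds (Real.exp y / √(2 * Real.pi))) := by
  choose K hK0 hK using fun n => exists_tilted_pkMeasure_Ioc_eq hk (hσ0 n) n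
  refine ⟨fun n => K n / σ n, fun n => div_pos (hK0 n) (hσ0 n), fun y hy => ?_⟩
  have hnn : ∀ a : ℝ, -1 ≤ a → ∀ᶠ n in atTop, 0 ≤ n + a / σ n := fun a ha => by
    filter_upwards [hnσ.eventually_ge_atTop 1] with n hn
    have h1 : (-1 : ℝ) / σ n ≤ a / σ n := by
      have := hσ0 n
      gcongr
    have h2 : 1 / σ n ≤ n := by
      rw [div_le_iff₀ (hσ0 n)]
      exact hn
    rw [neg_div] at h1
    linarith
  have hs0 : 0 < √(2 * Real.pi) := by positivity
  refine tendsto_order.2 ⟨fun r hr => ?_, fun r hr => ?_⟩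
  · have hg : Tendsto (fun δ : ℝ => Real.exp (-y - y ^ 2 / 2) * Real.exp (y - δ) /
        √(2 * Real.pi) / Real.exp (-(y - δ) - (y - δ) ^ 2 / 2)) (nhdsWithin 0 (Set.Ioi 0))
        (nhds (Real.exp y / √(2 * Real.pi))) := by
      refine tendsto_nhdsWithin_of_tendsto_nhds ?_
      refine Continuous.tendsto' ?_ _ _ ?_
      · exact Continuous.div₀ (by fun_prop) (by fun_prop) fun _ => (Real.exp_pos _).ne'
      · rw [sub_zero]
        field_simp
    obtain ⟨δ, hgδ, hδy, hδ0⟩ := ((hg.eventually_const_lt hr).and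
      ((tendsto_nhdsWithin_of_tendsto_nhds tendsto_id |>.eventually_lt_const
        (show (0 : ℝ) < y + 1 by linarith)).and self_mem_nhdsWithin)).exists
    have hδ0' : (0 : ℝ) < δ := hδ0
    have hδy' : δ < y + 1 := hδy
    have ha : -1 ≤ y - δ := by linarith
    have hlim := (hIoc (y - δ) y).div ((hσ.const_add δ).mul_const
      (Real.exp (-(y - δ) - (y - δ) ^ 2 / 2))) (by
        rw [add_zero]
        positivity)
    have hlt : r < (ProbabilityTheory.gaussianReal 0 1).real (Set.Ioc (y - δ) y) /
        ((δ + 0) * Real.exp (-(y - δ) - (y - δ) ^ 2 / 2)) := by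
      refine hgδ.trans_le ?_
      rw [add_zero, div_le_div_iff₀ (Real.exp_pos _) (by positivity), ← mul_assoc]
      refine mul_le_mul_of_nonneg_right ?_ (Real.exp_pos _).le
      refine le_trans (le_of_eq ?_) (le_gaussianReal_real_Ioc ha (by linarith))
      ring
    filter_upwards [hlim.eventually_const_lt hlt, hnn _ ha] with n hn hna
    refine hn.trans_le ?_
    have hσn := hσ0 n
    rw [Pi.div_apply, div_le_iff₀ (by positivity), hK n _ _ hna]
    refine (mul_le_mul_of_nonneg_left (sum_Ioc_pk_le hk hσn ha (by linarith) hna)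
      (hK0 n).le).trans (le_of_eq ?_)
    rw [sub_sub_cancel]
    field_simp
  · have hg : Tendsto (fun δ : ℝ => Real.exp (-y - y ^ 2 / 2) * Real.exp (y + δ) /
        √(2 * Real.pi) / Real.exp (-(y + δ) - (y + δ) ^ 2 / 2)) (nhdsWithin 0 (Set.Ioi 0))
        (nhds (Real.exp y / √(2 * Real.pi))) := by
      refine tendsto_nhdsWithin_of_tendsto_nhds ?_
      refine Continuous.tendsto' ?_ _ _ ?_
      · exact Continuous.div₀ (by fun_prop) (by fun_prop) fun _ => (Real.exp_pos _).ne'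
      · rw [add_zero]
        field_simp
    obtain ⟨δ, hgδ, hδ0⟩ := ((hg.eventually_lt_const hr).and self_mem_nhdsWithin).exists
    have hδ0' : (0 : ℝ) < δ := hδ0
    have hlim := (hIoc y (y + δ)).div ((hσ.const_sub δ).mul_const
      (Real.exp (-(y + δ) - (y + δ) ^ 2 / 2))) (by
        rw [sub_zero]
        positivity)
    have hlt : (ProbabilityTheory.gaussianReal 0 1).real (Set.Ioc y (y + δ)) /
        ((δ - 0) * Real.exp (-(y + δ) - (y + δ) ^ 2 / 2)) < r := by
      refine lt_of_le_of_lt ?_ hgδ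
      rw [sub_zero, div_le_div_iff₀ (by positivity) (Real.exp_pos _), ← mul_assoc]
      refine mul_le_mul_of_nonneg_right ?_ (Real.exp_pos _).le
      refine (gaussianReal_real_Ioc_le hy.le (by linarith)).trans (le_of_eq ?_)
      ring
    filter_upwards [hlim.eventually_lt_const hlt, hnn _ hy.le, hσ.eventually_lt_const hδ0']
      with n hn hna hσδ
    refine lt_of_le_of_lt ?_ hn
    have hσn := hσ0 n
    have hδσ : 0 < δ - σ n := by linarith
    rw [Pi.div_apply, le_div_iff₀ (by positivity), hK n _ _ hna]
    refine le_trans (le_of_eq ?_) (mul_le_mul_of_nonneg_left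
      (le_sum_Ioc_pk hk hσn hy.le (by linarith) hna) (hK0 n).le)
    rw [add_sub_cancel_left]
    field_simp

theorem pk_sub_pk_eq_sum {k : ℕ} (hk : k ≠ 0) {m n : ℕ} (hmn : m ≤ n) :
    (pk k n : ℝ) - pk k m = ∑ j ∈ Finset.Ioc m n, (pkTail k 1 j : ℝ) := by
  induction n, hmn using Nat.le_induction with
  | base => simp
  | succ n hmn ih =>
    rw [← Finset.insert_Ioc_right_eq_Ioc_add_one hmn, Finset.sum_insert (by simp), ← ih,
      pk_succ hk]
    push_cast
    ring

theorem tendsto_exp_sub_exp_div :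
    Tendsto (fun ε : ℝ => (Real.exp (2 * ε) - Real.exp ε) / ε) (nhdsWithin 0 {0}ᶜ) (nhds 1) := by
  have h1 : HasDerivAt (fun ε : ℝ => Real.exp (2 * ε) - Real.exp ε) 1 0 := by
    have := (((hasDerivAt_id (0 : ℝ)).const_mul 2).exp).sub (Real.hasDerivAt_exp 0)
    norm_num at this
    exact this
  have h2 := hasDerivAt_iff_tendsto_slope.1 h1
  refine h2.congr fun ε => ?_
  rw [slope_def_field]
  simp

theorem tendsto_pk_sub_div {k : ℕ} (hk : k ≠ 0) {σ : ℕ → ℝ} (hσ0 : ∀ n, 0 < σ n)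
    (hσ : Tendsto σ atTop (nhds 0)) (hnσ : Tendsto (fun n => n * σ n) atTop atTop)
    {W : ℕ → ℝ} (hW0 : ∀ n, 0 < W n) {c : ℝ} (hc : 0 < c)
    (hW : ∀ y : ℝ, -1 < y →
      Tendsto (fun n => W n * pk k ⌊n + y / σ n⌋₊) atTop (nhds (Real.exp y / c))) :
    Tendsto (fun n => ((pk k (n + 1) : ℝ) - pk k n) / (pk k n * σ n)) atTop (nhds 1) := by
  obtain ⟨H, hH⟩ := exists_pkTail_one_le (k := k)
  have hp0 : ∀ n, (0 : ℝ) < pk k n := fun n => by exact_mod_cast pk_pos hk n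
  have hWn : Tendsto (fun n => W n * pk k n) atTop (nhds (1 / c)) := by
    have := hW 0 (by norm_num)
    simpa only [zero_div, add_zero, Nat.floor_natCast, Real.exp_zero] using this
  have hsucc : ∀ n, (pk k (n + 1) : ℝ) - pk k n = pkTail k 1 (n + 1) := fun n => by
    rw [pk_succ hk]
    push_cast
    ring
  have hnn : ∀ a : ℝ, -1 ≤ a → ∀ᶠ n in atTop, 0 ≤ n + a / σ n := fun a ha => by
    filter_upwards [hnσ.eventually_ge_atTop 1] with n hn
    have h1 : (-1 : ℝ) / σ n ≤ a / σ n := by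
      have := hσ0 n
      gcongr
    have h2 : 1 / σ n ≤ n := by
      rw [div_le_iff₀ (hσ0 n)]
      exact hn
    rw [neg_div] at h1
    linarith
  have hinv : Tendsto (fun n => (σ n)⁻¹) atTop atTop :=
    (tendsto_nhdsWithin_iff.2 ⟨hσ, Eventually.of_forall hσ0⟩).inv_tendsto_nhdsGT_zero
  have hquot : ∀ a b : ℝ, -1 < a → -1 < b → Tendsto (fun n =>
      (W n * pk k ⌊n + b / σ n⌋₊ - W n * pk k ⌊n + a / σ n⌋₊) / (W n * pk k n)) atTop
      (nhds (Real.exp b - Real.exp a)) := fun a b ha hb => by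
    have h := ((hW b hb).sub (hW a ha)).div hWn (by positivity)
    have h2 : (Real.exp b / c - Real.exp a / c) / (1 / c) = Real.exp b - Real.exp a := by
      field_simp
    rwa [h2] at h
  refine tendsto_order.2 ⟨fun r hr => ?_, fun r hr => ?_⟩
  · have hg : Tendsto (fun ε : ℝ => (Real.exp (2 * ε) - Real.exp ε) / ε) (nhdsWithin 0 (Set.Iio 0))
        (nhds 1) := tendsto_exp_sub_exp_div.mono_left
          (nhdsWithin_mono _ fun x (hx : x < 0) => hx.ne)
    obtain ⟨ε, hgε, hε1, hε0⟩ := ((hg.eventually_const_lt hr).and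
      ((tendsto_nhdsWithin_of_tendsto_nhds tendsto_id |>.eventually_const_lt
        (show -(1 / 2) < (0 : ℝ) by norm_num)).and self_mem_nhdsWithin)).exists
    have hε0' : ε < 0 := hε0
    have hε1' : -(1 / 2) < ε := hε1
    have hlim := (hquot (2 * ε) ε (by linarith) (by linarith)).div (hσ.const_add (-ε)) (by
      rw [add_zero]
      linarith)
    have hval : (Real.exp ε - Real.exp (2 * ε)) / (-ε + 0) =
        (Real.exp (2 * ε) - Real.exp ε) / ε := by
      rw [add_zero, div_neg, ← neg_div, neg_sub]
    rw [hval] at hlim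
    filter_upwards [hlim.eventually_const_lt hgε, hnn (2 * ε) (by linarith),
      hinv.eventually_ge_atTop (H / -ε)] with n hn hna hnH
    refine hn.trans_le ?_
    have hσn := hσ0 n
    have hs : 2 * ε / σ n ≤ ε / σ n := by
      gcongr
      linarith
    have hst : ⌊n + 2 * ε / σ n⌋₊ ≤ ⌊n + ε / σ n⌋₊ := Nat.floor_le_floor (by linarith)
    have hsum := pk_sub_pk_eq_sum hk hst
    have hle : (pk k ⌊n + ε / σ n⌋₊ : ℝ) - pk k ⌊n + 2 * ε / σ n⌋₊ ≤
        pkTail k 1 (n + 1) * (-ε / σ n + 1) := by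
      rw [hsum]
      calc _ ≤ ∑ j ∈ Finset.Ioc ⌊n + 2 * ε / σ n⌋₊ ⌊n + ε / σ n⌋₊, (pkTail k 1 (n + 1) : ℝ) := by
            refine Finset.sum_le_sum fun j hj => ?_
            have hj1 : (j : ℝ) ≤ n + ε / σ n :=
              (Nat.le_floor_iff (by linarith)).1 (Finset.mem_Ioc.1 hj).2
            have h3 : (H : ℝ) ≤ -(ε / σ n) := by
              rw [div_le_iff₀ (by linarith)] at hnH
              rw [div_eq_mul_inv]
              linarith
            have h4 : j + H ≤ n + 1 := by
              have : (j + H : ℝ) ≤ n + 1 := by linarith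
              exact_mod_cast this
            exact_mod_cast hH j (n + 1) h4
        _ = pkTail k 1 (n + 1) *
              ((Finset.Ioc ⌊n + 2 * ε / σ n⌋₊ ⌊n + ε / σ n⌋₊).card : ℝ) := by
            rw [Finset.sum_const, nsmul_eq_mul, mul_comm]
        _ ≤ _ := by
            gcongr
            refine (card_Ioc_floor_le hna (by linarith)).trans (le_of_eq ?_)
            ring
    have hpn := hp0 n
    have hWn0 := hW0 n
    rw [Pi.div_apply, hsucc, ← mul_sub, mul_div_mul_left _ _ hWn0.ne', div_div,
      div_le_div_iff₀ (mul_pos hpn (by linarith)) (by positivity)]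
    calc _ ≤ pkTail k 1 (n + 1) * (-ε / σ n + 1) * (pk k n * σ n) := by gcongr
      _ = _ := by field_simp
  · have hg : Tendsto (fun ε : ℝ => (Real.exp (2 * ε) - Real.exp ε) / ε) (nhdsWithin 0 (Set.Ioi 0))
        (nhds 1) := tendsto_exp_sub_exp_div.mono_left
          (nhdsWithin_mono _ fun x (hx : 0 < x) => hx.ne')
    obtain ⟨ε, hgε, hε0⟩ := ((hg.eventually_lt_const hr).and self_mem_nhdsWithin).exists
    have hε0' : 0 < ε := hε0
    have hlim := (hquot ε (2 * ε) (by linarith) (by linarith)).div (hσ.const_sub ε) (by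
      rw [sub_zero]
      exact hε0'.ne')
    rw [sub_zero] at hlim
    filter_upwards [hlim.eventually_lt_const hgε, hσ.eventually_lt_const hε0',
      hinv.eventually_ge_atTop ((H + 1) / ε)] with n hn hσε hnH
    refine lt_of_le_of_lt ?_ hn
    have hσn := hσ0 n
    have hs : ε / σ n ≤ 2 * ε / σ n := by
      gcongr
      linarith
    have hna : 0 ≤ n + ε / σ n := by positivity
    have hst : ⌊n + ε / σ n⌋₊ ≤ ⌊n + 2 * ε / σ n⌋₊ := Nat.floor_le_floor (by linarith)
    have hsum := pk_sub_pk_eq_sum hk hst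
    have hle : pkTail k 1 (n + 1) * (ε / σ n - 1) ≤
        (pk k ⌊n + 2 * ε / σ n⌋₊ : ℝ) - pk k ⌊n + ε / σ n⌋₊ := by
      rw [hsum]
      calc _ ≤ pkTail k 1 (n + 1) *
              ((Finset.Ioc ⌊n + ε / σ n⌋₊ ⌊n + 2 * ε / σ n⌋₊).card : ℝ) := by
            gcongr
            refine le_trans (le_of_eq ?_) (le_card_Ioc_floor hna (by linarith))
            ring
        _ = ∑ j ∈ Finset.Ioc ⌊n + ε / σ n⌋₊ ⌊n + 2 * ε / σ n⌋₊, (pkTail k 1 (n + 1) : ℝ) := by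
            rw [Finset.sum_const, nsmul_eq_mul, mul_comm]
        _ ≤ _ := by
            refine Finset.sum_le_sum fun j hj => ?_
            have hj1 : n + ε / σ n < j := (Nat.floor_lt hna).1 (Finset.mem_Ioc.1 hj).1
            have h3 : (H : ℝ) + 1 ≤ ε / σ n := by
              rw [div_le_iff₀ hε0'] at hnH
              rw [div_eq_mul_inv]
              linarith
            have h4 : n + 1 + H ≤ j := by
              have : (n + 1 + H : ℝ) ≤ j := by linarith
              exact_mod_cast this
            exact_mod_cast hH (n + 1) j h4
    have hpn := hp0 n
    have hWn0 := hW0 n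
    have hεσ : 0 < ε - σ n := by linarith
    rw [Pi.div_apply, hsucc, ← mul_sub, mul_div_mul_left _ _ hWn0.ne', div_div,
      div_le_div_iff₀ (by positivity) (by positivity)]
    calc _ = pkTail k 1 (n + 1) * (ε / σ n - 1) * (pk k n * σ n) := by field_simp
      _ ≤ _ := by gcongr

theorem zetaR_pos {s : ℝ} (hs : 1 < s) : 0 < zetaR s := by
  have h := hasSum_zetaR hs
  rw [← h.tsum_eq]
  exact h.summable.tsum_pos (fun l => by positivity) 0 (by positivity)

theorem tendsto_pk_sub_div_of_saddle_point {k : ℕ} (hk : k ≠ 0) {σ : ℕ → ℝ} {B : ℝ}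
    (hσ0 : ∀ n, 0 < σ n) (hσ : Tendsto σ atTop (nhds 0))
    (hnσ : Tendsto (fun n => n * σ n) atTop atTop)
    (hB : ∀ᶠ n in atTop, |∑' m, cumulantTerm k (σ n) 1 m - n * σ n| ≤ B) :
    Tendsto (fun n => ((pk k (n + 1) : ℝ) - pk k n) / (pk k n * σ n)) atTop (nhds 1) := by
  have hσ' : Tendsto σ atTop (nhdsWithin 0 (Set.Ioi 0)) :=
    tendsto_nhdsWithin_iff.2 ⟨hσ, Eventually.of_forall hσ0⟩
  have hp : ∀ n, MeasureTheory.IsProbabilityMeasure (pkMeasure k (σ n) (n * σ n)) :=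
    fun n => isProbabilityMeasure_pkMeasure hk (hσ0 n) _
  obtain ⟨C, -, hC⟩ := exists_norm_pkRatio_le hk
  have hIoc := tendsto_tilted_Ioc (ν := fun n => pkMeasure k (σ n) (n * σ n))
    (C := C) ((tendsto_tsum_cumulantTerm_two hk).comp hσ')
    (Eventually.of_forall fun n u => by
      rw [charFun_pkMeasure hk (hσ0 n), norm_mul, ← neg_mul, ← Complex.ofReal_neg,
        Complex.norm_exp_ofReal_mul_I, one_mul]
      exact hC (σ n) (hσ0 n) u)
    (fun v => (tendsto_cexp_mul_pkRatio hk hσ' hB v).congr fun n =>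
      (charFun_pkMeasure hk (hσ0 n) _ _).symm)
  obtain ⟨W, hW0, hW⟩ := exists_tendsto_mul_pk_floor hk hσ0 hσ hnσ hIoc
  exact tendsto_pk_sub_div hk hσ0 hσ hnσ hW0 (Real.sqrt_pos.2 (by positivity)) hW

/-- **Corollary.** If for each large `n`, `X n > 0` satisfies the defining equation, then
`p^k(n+1) - p^k(n) ∼ p^k(n)/X(n)` as `n → ∞`. -/
theorem power_partitions_difference_equiv (k : ℕ) (hk : 2 ≤ k) (X : ℕ → ℝ)
    (hX : ∀ᶠ n : ℕ in Filter.atTop, 0 < X n ∧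
      (n : ℝ) = X n * ((1 / (k : ℝ) ^ 2) * zetaR (((k : ℝ) + 1) / k) * Real.Gamma (1 / k) *
          X n ^ ((k : ℝ)⁻¹) - 1 / 2 - (1 / 2) * zetaR (-(k : ℝ)) * (X n)⁻¹)) :
    Filter.Tendsto
      (fun n : ℕ => ((pk k (n + 1) : ℝ) - (pk k n : ℝ)) / ((pk k n : ℝ) / X n))
      Filter.atTop (nhds 1) := by
  have hk' : k ≠ 0 := by omega
  have hk0 : (0 : ℝ) < k := by positivity
  set c := (1 / (k : ℝ) ^ 2) * zetaR (((k : ℝ) + 1) / k) * Real.Gamma (1 / k) with hc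
  set z := zetaR (-(k : ℝ)) with hz
  have hc0 : 0 < c := by
    have h1 : 0 < zetaR (((k : ℝ) + 1) / k) := zetaR_pos (by
      rw [one_lt_div hk0]
      linarith)
    have h2 : 0 < Real.Gamma (1 / k) := Real.Gamma_pos_of_pos (by positivity)
    positivity
  have hXtop : Tendsto X atTop atTop := by
    refine tendsto_atTop.2 fun R => ?_
    filter_upwards [hX, tendsto_natCast_atTop_atTop.eventually_gt_atTop
      (|R| * (c * |R| ^ ((k : ℝ)⁻¹)) + |z|)] with n hn hnR
    by_contra! hlt
    obtain ⟨hX0, hXn⟩ := hn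
    have h1 : X n ≤ |R| := hlt.le.trans (le_abs_self R)
    have h2 : X n * (c * X n ^ ((k : ℝ)⁻¹)) ≤ |R| * (c * |R| ^ ((k : ℝ)⁻¹)) := by gcongr
    have h3 : (n : ℝ) = X n * (c * X n ^ ((k : ℝ)⁻¹)) - X n / 2 - z / 2 := by
      rw [hXn]
      field_simp
    linarith [neg_abs_le z, abs_nonneg z]
  set σ : ℕ → ℝ := fun n => if 0 < X n then (X n)⁻¹ else 1 with hσdef
  have hσeq : ∀ᶠ n in atTop, σ n = (X n)⁻¹ := by
    filter_upwards [hX] with n hn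
    exact if_pos hn.1
  have hσ0 : ∀ n, 0 < σ n := fun n => by
    by_cases h : 0 < X n <;> simp [hσdef, h]
  have hσ : Tendsto σ atTop (nhds 0) :=
    hXtop.inv_tendsto_atTop.congr' (hσeq.mono fun n hn => hn.symm)
  have hmean : ∀ᶠ n in atTop, n * σ n = c * X n ^ ((k : ℝ)⁻¹) - 1 / 2 - 1 / 2 * z * σ n := by
    filter_upwards [hX, hσeq] with n hn hσn
    obtain ⟨hX0, hXn⟩ := hn
    rw [hσn]
    nth_rewrite 1 [hXn]
    field_simp
  have hzσ : Tendsto (fun n => 1 / 2 * z * σ n) atTop (nhds 0) := by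
    simpa using hσ.const_mul (1 / 2 * z)
  have hnσ : Tendsto (fun n => n * σ n) atTop atTop := by
    have h1 : Tendsto (fun n => c * X n ^ ((k : ℝ)⁻¹)) atTop atTop :=
      ((tendsto_rpow_atTop (inv_pos.2 hk0)).comp hXtop).const_mul_atTop hc0
    have h2 := h1.atTop_add ((hzσ.const_add (1 / 2)).neg)
    refine h2.congr' (hmean.mono fun n hn => ?_)
    linarith
  have hB : ∀ᶠ n in atTop, |∑' m, cumulantTerm k (σ n) 1 m - n * σ n| ≤ 3 := by
    filter_upwards [hX, hσeq, hmean, hzσ.eventually_lt_const one_pos,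
      hzσ.eventually_const_lt (neg_lt_zero.2 one_pos)] with n hn hσn hmn hz1 hz2
    have h1 := abs_tsum_cumulantTerm_one_sub_le hk' (hσ0 n)
    have h2 : σ n ^ (-(k : ℝ)⁻¹) = X n ^ ((k : ℝ)⁻¹) := by
      rw [hσn, Real.inv_rpow hn.1.le, Real.rpow_neg hn.1.le, inv_inv]
    rw [h2, ← hc, abs_le] at h1
    rw [hmn, abs_le]
    constructor <;> linarith [h1.1, h1.2]
  refine (tendsto_pk_sub_div_of_saddle_point hk' hσ0 hσ hnσ hB).congr' ?_
  filter_upwards [hσeq] with n hn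
  rw [hn, ← div_eq_mul_inv]
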